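/- Let λ, μ ∈ ℝ and let u : ℂ → ℂ be of the form u(z) = f(z) e^{−|z|²/2} with f entire and f not identically zero, such that u is bounded on ℂ, u(z) → 0 as |z| → ∞, and for every z ∈ ℂ: λ u(z) + μ z f′(z) e^{−|z|²/2} = Π(|u|² u)(z). For R > 0 set N(R) = #{z ∈ ℂ : u(z) = 0 and |z| < R}. Then for every η > η₀ := (1/2 + (1/2)·(log 2/log 3))^{−1}, N(R)/R^η → 0 as R → ∞. -/

import Mathlib

open MeasureTheory

/-- The lowest Landau level projector, given by the kernel
`K(z,w) = (1/π) e^{-|z|²/2 - |w|²/2 + w̄ z}`. -/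
noncomputable def LLLProj (u : ℂ → ℂ) (z : ℂ) : ℂ :=
  (Real.pi : ℂ)⁻¹ * Complex.exp (-(‖z‖ : ℂ) ^ 2 / 2) *
    ∫ w : ℂ, Complex.exp ((starRingEnd ℂ) w * z - (‖w‖ : ℂ) ^ 2 / 2) * u w

theorem gauss_integral {b : ℝ} (hb : 0 < b) :
    ∫ w : ℂ, Real.exp (-b * ‖w‖ ^ 2) = Real.pi / b := by
  have h := Complex.integral_exp_neg_mul_rpow (p := 2) (by norm_num) hb
  have h2 : (2 / 2 + 1 : ℝ) = 2 := by norm_num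
  rw [h2, Real.Gamma_two] at h
  have h3 : b ^ (-2 / 2 : ℝ) = b⁻¹ := by
    rw [show (-2 / 2 : ℝ) = -1 by norm_num, Real.rpow_neg_one]
  rw [h3] at h
  simp only [Real.rpow_ofNat] at h
  rw [h]; field_simp

theorem gauss_integrable {b : ℝ} (hb : 0 < b) :
    Integrable (fun w : ℂ => Real.exp (-b * ‖w‖ ^ 2)) := by
  apply Integrable.of_integral_ne_zero
  rw [gauss_integral hb]
  positivity

theorem gauss_moment_diag {b : ℝ} (hb : 0 < b) (p : ℕ) :
    ∫ w : ℂ, ‖w‖ ^ (2 * p) * Real.exp (-b * ‖w‖ ^ 2) = Real.pi * p.factorial / b ^ (p + 1) := by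
  have h := Complex.integral_rpow_mul_exp_neg_mul_rpow (p := 2) (q := ((2 * p : ℕ) : ℝ))
    (by norm_num) (by have : (0:ℝ) ≤ ((2 * p : ℕ) : ℝ) := by positivity
                      linarith) hb
  simp only [Real.rpow_ofNat, Real.rpow_natCast] at h
  rw [h]
  have e1 : (((2 * p : ℕ) : ℝ) + 2) / 2 = (p : ℝ) + 1 := by push_cast; ring
  have e2 : -(((2 * p : ℕ) : ℝ) + 2) / 2 = -((p + 1 : ℕ) : ℝ) := by push_cast; ring
  rw [e1, e2, Real.Gamma_nat_eq_factorial, Real.rpow_neg hb.le, Real.rpow_natCast]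
  field_simp

theorem gauss_moment_off {b : ℝ} {p q : ℕ} (hpq : p ≠ q) :
    ∫ w : ℂ, w ^ p * (starRingEnd ℂ) w ^ q * (Real.exp (-b * ‖w‖ ^ 2) : ℂ) = 0 := by
  set I := ∫ w : ℂ, w ^ p * (starRingEnd ℂ) w ^ q * (Real.exp (-b * ‖w‖ ^ 2) : ℂ) with hI
  obtain ⟨c, hc⟩ : ∃ c : Circle, (c : ℂ) ^ p * (starRingEnd ℂ) (c : ℂ) ^ q = -1 := by
    have hd : ((p : ℂ) - q) ≠ 0 := by
      rw [sub_ne_zero]; exact_mod_cast hpq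
    refine ⟨Circle.exp (Real.pi / ((p : ℝ) - q)), ?_⟩
    rw [Circle.coe_exp, ← Complex.exp_conj, ← Complex.exp_nat_mul, ← Complex.exp_nat_mul,
      ← Complex.exp_add, ← Complex.exp_pi_mul_I]
    congr 1
    simp only [map_mul, Complex.conj_ofReal, Complex.conj_I]
    push_cast
    field_simp
    ring
  have h1 : ∫ w : ℂ, (fun w : ℂ => w ^ p * (starRingEnd ℂ) w ^ q *
      (Real.exp (-b * ‖w‖ ^ 2) : ℂ)) (rotation c w) = I :=
    (rotation c).measurePreserving.integral_comp
      (rotation c).toHomeomorph.measurableEmbedding (fun w : ℂ => w ^ p * (starRingEnd ℂ) w ^ q *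
      (Real.exp (-b * ‖w‖ ^ 2) : ℂ))
  have h2 : ∫ w : ℂ, (fun w : ℂ => w ^ p * (starRingEnd ℂ) w ^ q *
      (Real.exp (-b * ‖w‖ ^ 2) : ℂ)) (rotation c w) = -1 * I := by
    rw [hI, ← integral_const_mul]
    congr 1
    ext w
    simp only [rotation_apply, map_mul, mul_pow, norm_mul, Circle.norm_coe, one_mul]
    rw [← hc]; ring
  have h3 : I = -1 * I := h1.symm.trans h2
  have h4 : (2 : ℂ) * I = 0 := by linear_combination h3
  simpa using h4

theorem gauss_moment {b : ℝ} (hb : 0 < b) (p : ℕ) :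
    ∫ w : ℂ, w ^ p * (starRingEnd ℂ) w ^ p * (Real.exp (-b * ‖w‖ ^ 2) : ℂ) =
      ((Real.pi * p.factorial / b ^ (p + 1) : ℝ) : ℂ) := by
  rw [← gauss_moment_diag hb p, ← integral_complex_ofReal]
  congr 1
  ext w
  rw [← mul_pow, Complex.mul_conj, Complex.normSq_eq_norm_sq]
  push_cast
  rw [pow_mul]

/-- Gaussian pairing of an antiholomorphic and a holomorphic power series. -/
theorem gauss_pairing {b β C : ℝ} (hb : 0 < b) (hβ : β < b) (n : ℕ) (A D : ℕ → ℂ)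
    (F G : ℂ → ℂ)
    (hF : ∀ w, HasSum (fun m => A m * (starRingEnd ℂ) w ^ m) (F w))
    (hG : ∀ w, HasSum (fun m => D m * w ^ m) (G w))
    (hA : ∀ r : ℝ, 0 ≤ r → Summable fun m => ‖A m‖ * r ^ m)
    (hD : ∀ r : ℝ, 0 ≤ r → Summable fun m => ‖D m‖ * r ^ m)
    (hbd : ∀ r : ℝ, 0 ≤ r → r ^ n * ((∑' m, ‖A m‖ * r ^ m) * (∑' m, ‖D m‖ * r ^ m))
      ≤ C * Real.exp (β * r ^ 2)) :
    HasSum (fun m => A m * D (m + n) *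
      ((Real.pi * (m + n).factorial / b ^ (m + n + 1) : ℝ) : ℂ))
      (∫ w : ℂ, (starRingEnd ℂ) w ^ n * F w * G w * (Real.exp (-b * ‖w‖ ^ 2) : ℂ)) := by
  obtain ⟨bound, hbound⟩ : ∃ bound : ℕ × ℕ → ℂ → ℝ, bound = fun i w =>
    ‖w‖ ^ n * ((‖A i.1‖ * ‖w‖ ^ i.1) * (‖D i.2‖ * ‖w‖ ^ i.2)) * Real.exp (-b * ‖w‖ ^ 2) :=
    ⟨_, rfl⟩
  have hs : ∀ w : ℂ, Summable fun i : ℕ × ℕ =>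
      (‖A i.1‖ * ‖w‖ ^ i.1) * (‖D i.2‖ * ‖w‖ ^ i.2) := fun w =>
    (hA ‖w‖ (norm_nonneg _)).mul_of_nonneg (hD ‖w‖ (norm_nonneg _))
      (fun m => by positivity) (fun m => by positivity)
  have hsb : ∀ w : ℂ, Summable fun i => bound i w := fun w => by
    rw [hbound]
    exact ((hs w).mul_left (‖w‖ ^ n)).mul_right _
  have htb : ∀ w : ℂ, ∑' i, bound i w =
      ‖w‖ ^ n * ((∑' m, ‖A m‖ * ‖w‖ ^ m) * (∑' m, ‖D m‖ * ‖w‖ ^ m)) *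
        Real.exp (-b * ‖w‖ ^ 2) := by
    intro w
    simp only [hbound]
    rw [tsum_mul_right, tsum_mul_left,
      (hA ‖w‖ (norm_nonneg _)).tsum_mul_tsum (hD ‖w‖ (norm_nonneg _)) (hs w)]
  have hmeasb : ∀ i, Measurable (bound i) := by
    intro i
    simp only [hbound]
    fun_prop
  have hm : ∀ i : ℕ × ℕ, AEStronglyMeasurable (fun w : ℂ => (A i.1 * D i.2) *
      (w ^ i.2 * (starRingEnd ℂ) w ^ (i.1 + n) * (Real.exp (-b * ‖w‖ ^ 2) : ℂ))) volume := by
    intro i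
    apply Continuous.aestronglyMeasurable
    have : Continuous (fun w : ℂ => (starRingEnd ℂ) w) := Complex.continuous_conj
    fun_prop
  have hle : ∀ i : ℕ × ℕ, ∀ w : ℂ, ‖(A i.1 * D i.2) *
      (w ^ i.2 * (starRingEnd ℂ) w ^ (i.1 + n) * (Real.exp (-b * ‖w‖ ^ 2) : ℂ))‖ ≤ bound i w := by
    intro i w
    simp only [hbound, norm_mul, norm_pow, RCLike.norm_conj, Complex.norm_real, Real.norm_eq_abs,
        Real.abs_exp, pow_add]
    apply le_of_eq; ring
  have hintg : Integrable (fun w => ∑' i, bound i w) volume := by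
    have hg := (gauss_integrable (b := b - β) (by linarith)).const_mul C
    refine hg.mono' ?_ (Filter.Eventually.of_forall fun w => ?_)
    · exact (Measurable.tsum hmeasb).aestronglyMeasurable
    · rw [htb, Real.norm_of_nonneg]
      · have := hbd ‖w‖ (norm_nonneg _)
        calc _ ≤ C * Real.exp (β * ‖w‖ ^ 2) * Real.exp (-b * ‖w‖ ^ 2) := by gcongr
          _ = _ := by rw [mul_assoc, ← Real.exp_add]; ring_nf
      · rw [← htb]
        exact tsum_nonneg fun i => by simp only [hbound]; positivity
  have hpt : ∀ w : ℂ, HasSum (fun i : ℕ × ℕ => (A i.1 * D i.2) *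
      (w ^ i.2 * (starRingEnd ℂ) w ^ (i.1 + n) * (Real.exp (-b * ‖w‖ ^ 2) : ℂ)))
      ((starRingEnd ℂ) w ^ n * F w * G w * (Real.exp (-b * ‖w‖ ^ 2) : ℂ)) := by
    intro w
    have h1 : Summable fun m => ‖A m * (starRingEnd ℂ) w ^ m‖ := by
      simpa using hA ‖w‖ (norm_nonneg _)
    have h2 : Summable fun m => ‖D m * w ^ m‖ := by
      simpa using hD ‖w‖ (norm_nonneg _)
    have h0 : Summable fun x : ℕ × ℕ => (A x.1 * (starRingEnd ℂ) w ^ x.1) * (D x.2 * w ^ x.2) :=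
      summable_mul_of_summable_norm (f := fun m => A m * (starRingEnd ℂ) w ^ m)
        (g := fun m => D m * w ^ m) h1 h2
    have h00 := HasSum.mul (hF w) (hG w) h0
    have h3 := (h00.mul_left
      ((starRingEnd ℂ) w ^ n)).mul_right ((Real.exp (-b * ‖w‖ ^ 2) : ℝ) : ℂ)
    have e : ((starRingEnd ℂ) w ^ n * F w * G w * (Real.exp (-b * ‖w‖ ^ 2) : ℂ)) =
      (starRingEnd ℂ) w ^ n * (F w * G w) * (Real.exp (-b * ‖w‖ ^ 2) : ℂ) := by ring
    rw [e]
    have e2 : (fun i : ℕ × ℕ => (A i.1 * D i.2) *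
      (w ^ i.2 * (starRingEnd ℂ) w ^ (i.1 + n) * (Real.exp (-b * ‖w‖ ^ 2) : ℂ))) =
      fun i => (starRingEnd ℂ) w ^ n * (A i.1 * (starRingEnd ℂ) w ^ i.1 * (D i.2 * w ^ i.2)) *
        (Real.exp (-b * ‖w‖ ^ 2) : ℂ) := by
      funext i
      rw [pow_add]; ring
    rw [e2]
    exact h3
  have key := hasSum_integral_of_dominated_convergence bound hm
    (fun i => ae_of_all _ (hle i)) (ae_of_all _ hsb) hintg (ae_of_all _ hpt)
  have hinj : Function.Injective (fun m : ℕ => (m, m + n)) := fun a b h => by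
    simpa using congrArg Prod.fst h
  have hval : ∀ i : ℕ × ℕ, (∫ w : ℂ, (A i.1 * D i.2) *
      (w ^ i.2 * (starRingEnd ℂ) w ^ (i.1 + n) * (Real.exp (-b * ‖w‖ ^ 2) : ℂ))) =
      if i.2 = i.1 + n then A i.1 * D i.2 *
        ((Real.pi * (i.1 + n).factorial / b ^ (i.1 + n + 1) : ℝ) : ℂ) else 0 := by
    intro i
    rw [integral_const_mul]
    split_ifs with h
    · rw [h, gauss_moment hb]
    · rw [gauss_moment_off h, mul_zero]
  simp only [hval] at key
  rw [← hinj.hasSum_iff] at key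
  · simpa [Function.comp_def] using key
  · rintro ⟨i, j⟩ hij
    rw [if_neg]
    rintro h
    exact hij ⟨i, by simp only at h; simp [h]⟩

theorem real_exp_hasSum (x : ℝ) : HasSum (fun n : ℕ => x ^ n / n.factorial) (Real.exp x) := by
  have := NormedSpace.expSeries_div_hasSum_exp (𝔸 := ℝ) x
  rwa [← Real.exp_eq_exp_ℝ] at this

theorem complex_exp_hasSum (x : ℂ) :
    HasSum (fun n : ℕ => x ^ n / n.factorial) (Complex.exp x) := by
  have := NormedSpace.expSeries_div_hasSum_exp (𝔸 := ℂ) x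
  rwa [← Complex.exp_eq_exp_ℂ] at this

theorem hasSum_congr_fun {ι E : Type*} [AddCommMonoid E] [TopologicalSpace E] {f g : ι → E} {a : E}
    (h : HasSum f a) (e : ∀ i, g i = f i) : HasSum g a := by
  have : g = f := funext e
  rwa [this]

/-- Taylor coefficients at the origin. -/
noncomputable def tc (f : ℂ → ℂ) (n : ℕ) : ℂ := (n.factorial : ℂ)⁻¹ * iteratedDeriv n f 0

theorem tc_hasSum {f : ℂ → ℂ} (hf : Differentiable ℂ f) (z : ℂ) :
    HasSum (fun n => tc f n * z ^ n) (f z) := by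
  have h := Complex.hasSum_taylorSeries_of_entire hf 0 z
  simp only [sub_zero, smul_eq_mul] at h
  have e : (fun n => tc f n * z ^ n) =
      fun n : ℕ => (n.factorial : ℂ)⁻¹ * (z ^ n * iteratedDeriv n f 0) := by
    funext n; simp only [tc]; ring
  rw [e]; exact h

theorem tc_bound {f : ℂ → ℂ} (hf : Differentiable ℂ f) {C α : ℝ}
    (hC : ∀ z, ‖f z‖ ≤ C * Real.exp (α * ‖z‖ ^ 2)) (n : ℕ) {r : ℝ} (hr : 0 ≤ r) :
    ‖tc f n‖ * r ^ n ≤ C * Real.exp (α * r ^ 2) := by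
  have hC0 : 0 ≤ C := by
    have := (norm_nonneg _).trans (hC 0)
    simpa using this
  rcases hr.eq_or_lt with rfl | hr
  · rcases Nat.eq_zero_or_pos n with rfl | hn
    · simpa [tc] using hC 0
    · simp [hn.ne', hC0]
  · have h := Complex.norm_iteratedDeriv_le_of_forall_mem_sphere_norm_le (c := 0) n hr
      hf.diffContOnCl (C := C * Real.exp (α * r ^ 2)) (fun z hz => by
        have : ‖z‖ = r := by simpa using hz
        simpa [this] using hC z)
    have hfac : (0 : ℝ) < n.factorial := by exact_mod_cast n.factorial_pos
    rw [tc, norm_mul, norm_inv, Complex.norm_natCast]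
    rw [le_div_iff₀ (by positivity)] at h
    rw [mul_assoc, inv_mul_le_iff₀ hfac]
    exact h

theorem tc_sum {f : ℂ → ℂ} (hf : Differentiable ℂ f) {C : ℝ}
    (hC : ∀ z, ‖f z‖ ≤ C * Real.exp ((1 / 2) * ‖z‖ ^ 2)) :
    ∃ C1 : ℝ, 0 ≤ C1 ∧ ∀ r : ℝ, 0 ≤ r → (Summable fun n => ‖tc f n‖ * r ^ n) ∧
      ∑' n, ‖tc f n‖ * r ^ n ≤ C1 * Real.exp (0.6 * r ^ 2) := by
  have hC0 : 0 ≤ C := by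
    have := (norm_nonneg _).trans (hC 0)
    simpa using this
  have hg : HasSum (fun n : ℕ => (1 / 1.09 : ℝ) ^ n) (1 - 1 / 1.09)⁻¹ :=
    hasSum_geometric_of_lt_one (by norm_num) (by norm_num)
  refine ⟨C * (1 - 1 / 1.09)⁻¹, by positivity, fun r hr => ?_⟩
  have hb : ∀ n, ‖tc f n‖ * r ^ n ≤ (C * Real.exp (0.6 * r ^ 2)) * (1 / 1.09 : ℝ) ^ n := by
    intro n
    have h := tc_bound hf hC n (r := 1.09 * r) (by positivity)
    have h2 : Real.exp (1 / 2 * (1.09 * r) ^ 2) ≤ Real.exp (0.6 * r ^ 2) := by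
      apply Real.exp_le_exp.2; nlinarith [sq_nonneg r]
    rw [mul_pow] at h
    rw [one_div, inv_pow, ← div_eq_mul_inv, le_div_iff₀ (by positivity)]
    calc _ = ‖tc f n‖ * (1.09 ^ n * r ^ n) := by ring
      _ ≤ _ := h
      _ ≤ _ := by gcongr
  have hs := hg.mul_left (C * Real.exp (0.6 * r ^ 2))
  have hsum : Summable fun n => ‖tc f n‖ * r ^ n :=
    Summable.of_nonneg_of_le (fun n => by positivity) hb hs.summable
  refine ⟨hsum, ?_⟩
  calc _ ≤ _ := hsum.tsum_le_tsum hb hs.summable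
    _ = _ := by rw [hs.tsum_eq]; ring

/-- Coefficients of the square. -/
noncomputable def sqc (a : ℕ → ℂ) (N : ℕ) : ℂ :=
  ∑ kl ∈ Finset.HasAntidiagonal.antidiagonal N, a kl.1 * a kl.2

theorem sqc_facts (a : ℕ → ℂ) (ha : ∀ r : ℝ, 0 ≤ r → Summable fun n => ‖a n‖ * r ^ n)
    (f : ℂ → ℂ) (hf : ∀ z, HasSum (fun n => a n * z ^ n) (f z)) :
    (∀ z, HasSum (fun n => sqc a n * z ^ n) (f z ^ 2)) ∧
    (∀ r : ℝ, 0 ≤ r → (Summable fun n => ‖sqc a n‖ * r ^ n) ∧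
      ∑' n, ‖sqc a n‖ * r ^ n ≤ (∑' n, ‖a n‖ * r ^ n) ^ 2) := by
  have h2 : ∀ r : ℝ, 0 ≤ r → (Summable fun n => ‖sqc a n‖ * r ^ n) ∧
      ∑' n, ‖sqc a n‖ * r ^ n ≤ (∑' n, ‖a n‖ * r ^ n) ^ 2 := by
    intro r hr
    have hn : Summable fun n => ‖‖a n‖ * r ^ n‖ := (ha r hr).norm
    have hp := tsum_mul_tsum_eq_tsum_sum_antidiagonal_of_summable_norm hn hn
    have hps := (summable_norm_sum_mul_antidiagonal_of_summable_norm hn hn).of_norm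
    have hle : ∀ n, ‖sqc a n‖ * r ^ n ≤
        ∑ kl ∈ Finset.HasAntidiagonal.antidiagonal n, (‖a kl.1‖ * r ^ kl.1) * (‖a kl.2‖ * r ^ kl.2) := by
      intro n
      calc ‖sqc a n‖ * r ^ n ≤ (∑ kl ∈ Finset.HasAntidiagonal.antidiagonal n, ‖a kl.1 * a kl.2‖) * r ^ n := by
            gcongr; exact norm_sum_le _ _
        _ = _ := by
            rw [Finset.sum_mul]
            refine Finset.sum_congr rfl fun kl hkl => ?_
            rw [← Finset.HasAntidiagonal.mem_antidiagonal.1 hkl, norm_mul, pow_add]; ring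
    have hs : Summable fun n => ‖sqc a n‖ * r ^ n :=
      Summable.of_nonneg_of_le (fun n => by positivity) hle hps
    refine ⟨hs, ?_⟩
    rw [sq, hp]
    exact hs.tsum_le_tsum hle hps
  refine ⟨fun z => ?_, h2⟩
  have hn : Summable fun n => ‖a n * z ^ n‖ := by simpa using ha ‖z‖ (norm_nonneg _)
  have hp := tsum_mul_tsum_eq_tsum_sum_antidiagonal_of_summable_norm hn hn
  rw [(hf z).tsum_eq] at hp
  have e : ∀ n, ∑ kl ∈ Finset.HasAntidiagonal.antidiagonal n, (a kl.1 * z ^ kl.1) * (a kl.2 * z ^ kl.2) =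
      sqc a n * z ^ n := by
    intro n
    rw [sqc, Finset.sum_mul]
    refine Finset.sum_congr rfl fun kl hkl => ?_
    rw [← Finset.HasAntidiagonal.mem_antidiagonal.1 hkl, pow_add]; ring
  simp only [e] at hp
  rw [sq, hp]
  apply Summable.hasSum
  have := (h2 ‖z‖ (norm_nonneg _)).1
  exact Summable.of_norm (by simpa using this)

theorem coeff_unique (a b : ℕ → ℂ) (g : ℂ → ℂ) (ha : ∀ z, HasSum (fun n => a n * z ^ n) (g z))
    (hb : ∀ z, HasSum (fun n => b n * z ^ n) (g z)) : a = b := by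
  have key : ∀ c : ℕ → ℂ, (∀ z, HasSum (fun n => c n * z ^ n) (g z)) →
      HasFPowerSeriesAt g (FormalMultilinearSeries.ofScalars ℂ c) 0 := by
    intro c hc
    rw [hasFPowerSeriesAt_iff]
    refine Filter.Eventually.of_forall fun z => ?_
    have := hc z
    simpa [FormalMultilinearSeries.coeff_ofScalars, mul_comm] using this
  have h := (key a ha).eq_formalMultilinearSeries (key b hb)
  funext n
  have := congrArg (fun p => FormalMultilinearSeries.coeff p n) h
  simpa [FormalMultilinearSeries.coeff_ofScalars] using this

theorem tc_euler {f : ℂ → ℂ} (hf : Differentiable ℂ f) (z : ℂ) :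
    HasSum (fun n : ℕ => ((n : ℂ) * tc f n) * z ^ n) (z * deriv f z) := by
  have hd : Differentiable ℂ (deriv f) := by
    intro z
    exact (hf.analyticAt z).deriv.differentiableAt
  have h := (tc_hasSum hd z).mul_left z
  have e : (fun n => z * (tc (deriv f) n * z ^ n)) =
      fun n => (((n + 1 : ℕ) : ℂ) * tc f (n + 1)) * z ^ (n + 1) := by
    funext n
    have : (n.factorial : ℂ) ≠ 0 := by exact_mod_cast n.factorial_ne_zero
    have h3 : ((n : ℂ) + 1) ≠ 0 := by exact_mod_cast n.succ_ne_zero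
    simp only [tc, Nat.factorial_succ, iteratedDeriv_succ']
    push_cast
    rw [pow_succ]
    field_simp
  rw [e] at h
  have := (hasSum_nat_add_iff (f := fun n : ℕ => ((n : ℂ) * tc f n) * z ^ n) 1).1 h
  simpa using this

theorem reproducing {f : ℂ → ℂ} (hf : Differentiable ℂ f) {C : ℝ}
    (hC : ∀ z, ‖f z‖ ≤ C * Real.exp ((1 / 2) * ‖z‖ ^ 2)) (z : ℂ) :
    ∫ w : ℂ, Complex.exp ((starRingEnd ℂ) w * z) * f w * (Real.exp (-1 * ‖w‖ ^ 2) : ℂ) =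
      Real.pi * f z := by
  obtain ⟨C1, hC1, h1⟩ := tc_sum hf hC
  have hexp : ∀ r : ℝ, HasSum (fun m : ℕ => ‖z ^ m / (m.factorial : ℂ)‖ * r ^ m)
      (Real.exp (‖z‖ * r)) := by
    intro r
    refine hasSum_congr_fun (real_exp_hasSum (‖z‖ * r)) fun m => ?_
    rw [norm_div, norm_pow, Complex.norm_natCast, mul_pow]; ring
  have key := gauss_pairing (b := 1) (β := 0.9) (C := C1 * Real.exp (‖z‖ ^ 2)) one_pos
    (by norm_num) 0 (fun m => z ^ m / (m.factorial : ℂ)) (tc f)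
    (fun w => Complex.exp ((starRingEnd ℂ) w * z)) f
    (fun w => by
      refine hasSum_congr_fun (complex_exp_hasSum ((starRingEnd ℂ) w * z)) fun m => ?_
      rw [mul_pow]; ring)
    (tc_hasSum hf) (fun r _ => (hexp r).summable) (fun r hr => (h1 r hr).1)
    (fun r hr => by
      rw [(hexp r).tsum_eq, pow_zero, one_mul]
      calc _ ≤ Real.exp (‖z‖ * r) * (C1 * Real.exp (0.6 * r ^ 2)) := by
            gcongr; exact (h1 r hr).2
        _ = C1 * Real.exp (‖z‖ * r + 0.6 * r ^ 2) := by rw [Real.exp_add]; ring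
        _ ≤ C1 * Real.exp (‖z‖ ^ 2 + 0.9 * r ^ 2) := by
            refine mul_le_mul_of_nonneg_left (Real.exp_le_exp.2 ?_) hC1
            nlinarith [sq_nonneg (‖z‖ - 0.5 * r), sq_nonneg r, norm_nonneg z]
        _ = _ := by rw [Real.exp_add]; ring)
  have h2 := (tc_hasSum hf z).mul_left (Real.pi : ℂ)
  have e : (fun m => z ^ m / (m.factorial : ℂ) * tc f (m + 0) *
      ((Real.pi * (m + 0).factorial / 1 ^ (m + 0 + 1) : ℝ) : ℂ)) =
      fun m => (Real.pi : ℂ) * (tc f m * z ^ m) := by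
    funext m
    have : (m.factorial : ℂ) ≠ 0 := by exact_mod_cast m.factorial_ne_zero
    push_cast
    simp only [add_zero, one_pow, div_one]
    field_simp
  rw [e] at key
  have := key.unique h2
  simpa using this

theorem coeff_relation {f : ℂ → ℂ} (hf : Differentiable ℂ f) {C : ℝ}
    (hC : ∀ z, ‖f z‖ ≤ C * Real.exp ((1 / 2) * ‖z‖ ^ 2)) (lam mu : ℂ)
    (heq : ∀ z : ℂ, lam * f z + mu * (z * deriv f z) = (Real.pi : ℂ)⁻¹ *
      ∫ w : ℂ, Complex.exp ((starRingEnd ℂ) w * z) *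
        ((starRingEnd ℂ) (f w) * f w ^ 2 * (Real.exp (-2 * ‖w‖ ^ 2) : ℂ))) (n : ℕ) :
    HasSum (fun m => (starRingEnd ℂ) (tc f m) * sqc (tc f) (m + n) *
      (((m + n).factorial / (n.factorial * 2 ^ (m + n + 1)) : ℝ) : ℂ))
      ((lam + mu * n) * tc f n) := by
  obtain ⟨C1, hC1, h1⟩ := tc_sum hf hC
  have hC0 : 0 ≤ C := by
    have := (norm_nonneg _).trans (hC 0)
    simpa using this
  obtain ⟨hq1, hq2⟩ := sqc_facts (tc f) (fun r hr => (h1 r hr).1) f (tc_hasSum hf)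
  obtain ⟨Q, hQ⟩ : ∃ Q : ℂ → ℂ, Q = fun w =>
    (starRingEnd ℂ) (f w) * f w ^ 2 * (Real.exp (-2 * ‖w‖ ^ 2) : ℂ) := ⟨_, rfl⟩
  have hQc : Continuous Q := by
    have := hf.continuous
    have h2 : Continuous (fun w : ℂ => (starRingEnd ℂ) (f w)) := Complex.continuous_conj.comp this
    rw [hQ]; fun_prop
  have hQb : ∀ w, ‖Q w‖ ≤ C ^ 3 * Real.exp (-(1 / 2) * ‖w‖ ^ 2) := by
    intro w
    rw [hQ]
    simp only [norm_mul, norm_pow, RCLike.norm_conj, Complex.norm_real, Real.norm_eq_abs,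
        Real.abs_exp]
    calc ‖f w‖ * ‖f w‖ ^ 2 * Real.exp (-2 * ‖w‖ ^ 2) = ‖f w‖ ^ 3 * Real.exp (-2 * ‖w‖ ^ 2) := by
          ring
      _ ≤ (C * Real.exp ((1 / 2) * ‖w‖ ^ 2)) ^ 3 * Real.exp (-2 * ‖w‖ ^ 2) := by
          gcongr; exact hC w
      _ = C ^ 3 * (Real.exp ((1 / 2) * ‖w‖ ^ 2) ^ 3 * Real.exp (-2 * ‖w‖ ^ 2)) := by ring
      _ = _ := by
          rw [← Real.exp_nat_mul, ← Real.exp_add]; congr 2; push_cast; ring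
  have hser : ∀ z : ℂ, HasSum (fun k : ℕ => ((Real.pi : ℂ)⁻¹ * ((k.factorial : ℂ)⁻¹ *
      ∫ w : ℂ, (starRingEnd ℂ) w ^ k * Q w)) * z ^ k) (lam * f z + mu * (z * deriv f z)) := by
    intro z
    have hsb : ∀ w : ℂ, HasSum (fun k : ℕ => ((‖w‖ * ‖z‖) ^ k / k.factorial) *
        (C ^ 3 * Real.exp (-(1 / 2) * ‖w‖ ^ 2)))
        (Real.exp (‖w‖ * ‖z‖) * (C ^ 3 * Real.exp (-(1 / 2) * ‖w‖ ^ 2))) := fun w =>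
      (real_exp_hasSum _).mul_right _
    have hm : ∀ k : ℕ, AEStronglyMeasurable (fun w : ℂ =>
        (((starRingEnd ℂ) w * z) ^ k / k.factorial) * Q w) volume := by
      intro k
      apply Continuous.aestronglyMeasurable
      have : Continuous (fun w : ℂ => (starRingEnd ℂ) w) := Complex.continuous_conj
      fun_prop
    have hle : ∀ k : ℕ, ∀ w : ℂ, ‖(((starRingEnd ℂ) w * z) ^ k / k.factorial) * Q w‖ ≤
        ((‖w‖ * ‖z‖) ^ k / k.factorial) * (C ^ 3 * Real.exp (-(1 / 2) * ‖w‖ ^ 2)) := by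
      intro k w
      rw [norm_mul, norm_div, norm_pow, norm_mul, RCLike.norm_conj, Complex.norm_natCast]
      gcongr
      exact hQb w
    have hintg : Integrable (fun w : ℂ => ∑' k : ℕ, ((‖w‖ * ‖z‖) ^ k / k.factorial) *
        (C ^ 3 * Real.exp (-(1 / 2) * ‖w‖ ^ 2))) volume := by
      have e : (fun w : ℂ => ∑' k : ℕ, ((‖w‖ * ‖z‖) ^ k / k.factorial) *
        (C ^ 3 * Real.exp (-(1 / 2) * ‖w‖ ^ 2))) = fun w : ℂ =>
        (Real.exp (‖w‖ * ‖z‖) * (C ^ 3 * Real.exp (-(1 / 2) * ‖w‖ ^ 2))) :=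
        funext fun w => (hsb w).tsum_eq
      rw [e]
      have hg := (gauss_integrable (b := 1 / 4) (by norm_num)).const_mul
        (C ^ 3 * Real.exp (‖z‖ ^ 2))
      refine hg.mono' (by apply Continuous.aestronglyMeasurable; fun_prop) (ae_of_all _ fun w => ?_)
      rw [Real.norm_of_nonneg (by positivity)]
      calc _ = C ^ 3 * Real.exp (‖w‖ * ‖z‖ + -(1 / 2) * ‖w‖ ^ 2) := by rw [Real.exp_add]; ring
        _ ≤ C ^ 3 * Real.exp (‖z‖ ^ 2 + -(1 / 4) * ‖w‖ ^ 2) := by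
            refine mul_le_mul_of_nonneg_left (Real.exp_le_exp.2 ?_) (by positivity)
            nlinarith [sq_nonneg (‖z‖ - 0.5 * ‖w‖)]
        _ = _ := by rw [Real.exp_add]; ring
    have hpt : ∀ w : ℂ, HasSum (fun k : ℕ => (((starRingEnd ℂ) w * z) ^ k / k.factorial) * Q w)
        (Complex.exp ((starRingEnd ℂ) w * z) * Q w) := fun w =>
      (complex_exp_hasSum _).mul_right _
    have key := hasSum_integral_of_dominated_convergence _ hm
      (fun k => ae_of_all _ (hle k)) (ae_of_all _ fun w => (hsb w).summable) hintg (ae_of_all _ hpt)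
    have key2 := key.mul_left (Real.pi : ℂ)⁻¹
    rw [heq z]
    simp only [hQ] at key2 ⊢
    refine hasSum_congr_fun key2 fun k => ?_
    rw [mul_assoc, mul_assoc]
    congr 1
    rw [← integral_mul_const, ← integral_const_mul]
    congr 1
    funext w
    rw [mul_pow]; ring
  have hser2 : ∀ z : ℂ, HasSum (fun k : ℕ => ((lam + mu * k) * tc f k) * z ^ k)
      (lam * f z + mu * (z * deriv f z)) := by
    intro z
    refine hasSum_congr_fun (((tc_hasSum hf z).mul_left lam).add
      ((tc_euler hf z).mul_left mu)) fun k => ?_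
    ring
  have hco := congrFun (coeff_unique _ _ _ hser2 hser) n
  rw [hco]
  obtain ⟨Cn, hCn0, hCn⟩ : ∃ Cn : ℝ, 0 ≤ Cn ∧
      ∀ r : ℝ, 0 ≤ r → r ^ n ≤ Cn * Real.exp (0.1 * r ^ 2) := by
    refine ⟨n.factorial * Real.exp 10, by positivity, fun r hr => ?_⟩
    have h := Real.pow_div_factorial_le_exp r hr n
    rw [div_le_iff₀ (by positivity)] at h
    refine h.trans ?_
    rw [mul_comm, mul_assoc, ← Real.exp_add]
    gcongr
    nlinarith [sq_nonneg (r - 10)]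
  have key := gauss_pairing (b := 2) (β := 1.9) (C := Cn * C1 ^ 3) two_pos
    (by norm_num) n (fun m => (starRingEnd ℂ) (tc f m)) (sqc (tc f))
    (fun w => (starRingEnd ℂ) (f w)) (fun w => f w ^ 2)
    (fun w => by
      have := (tc_hasSum hf w).map (starRingEnd ℂ) Complex.continuous_conj
      refine hasSum_congr_fun this fun m => ?_
      simp)
    hq1 (fun r hr => by simpa using (h1 r hr).1) (fun r hr => (hq2 r hr).1)
    (fun r hr => by
      simp only [RCLike.norm_conj]
      have e1 := (h1 r hr).2
      have e2 := (hq2 r hr).2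
      have e0 : 0 ≤ ∑' n, ‖tc f n‖ * r ^ n := tsum_nonneg fun n => by positivity
      have e3 : 0 ≤ ∑' n, ‖sqc (tc f) n‖ * r ^ n := tsum_nonneg fun n => by positivity
      calc _ ≤ (Cn * Real.exp (0.1 * r ^ 2)) * ((C1 * Real.exp (0.6 * r ^ 2)) *
            (C1 * Real.exp (0.6 * r ^ 2)) ^ 2) := by
            gcongr
            · exact hCn r hr
            · exact e2.trans (by gcongr)
        _ = Cn * C1 ^ 3 * (Real.exp (0.1 * r ^ 2) * Real.exp (0.6 * r ^ 2) ^ 3) := by ring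
        _ = _ := by rw [← Real.exp_nat_mul, ← Real.exp_add]; congr 2; push_cast; ring)
  have key2 := (key.mul_left ((n.factorial : ℂ)⁻¹)).mul_left (Real.pi : ℂ)⁻¹
  have e : (∫ w : ℂ, (starRingEnd ℂ) w ^ n * Q w) =
    ∫ w : ℂ, (starRingEnd ℂ) w ^ n * (starRingEnd ℂ) (f w) * f w ^ 2 *
      (Real.exp (-2 * ‖w‖ ^ 2) : ℂ) := by
    congr 1
    funext w
    rw [hQ]; ring
  rw [e]
  refine hasSum_congr_fun key2 fun m => ?_
  have h3 : (n.factorial : ℂ) ≠ 0 := by exact_mod_cast n.factorial_ne_zero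
  have h4 : (Real.pi : ℂ) ≠ 0 := by exact_mod_cast Real.pi_ne_zero
  push_cast
  field_simp

/-- Square root of the factorial. -/
noncomputable def sf (n : ℕ) : ℝ := Real.sqrt n.factorial

theorem sf_pos (n : ℕ) : 0 < sf n := Real.sqrt_pos.2 (by exact_mod_cast n.factorial_pos)

theorem sf_sq (n : ℕ) : sf n ^ 2 = n.factorial := Real.sq_sqrt (by positivity)

theorem sf_binom {α β : ℝ} (hα : 0 ≤ α) (hβ : 0 ≤ β) (h : α ^ 2 + β ^ 2 = 1) (m n : ℕ) :
    sf (m + n) * α ^ m * β ^ n ≤ sf m * sf n := by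
  have hm := sf_pos m
  have hn := sf_pos n
  refine le_of_not_gt fun hlt => absurd (pow_lt_pow_left₀ hlt (by positivity) two_ne_zero) (not_lt.2 ?_)
  have h1 : (α ^ 2) ^ m * (β ^ 2) ^ n * ((m + n).choose m : ℝ) ≤ 1 := by
    have h2 := add_pow (α ^ 2) (β ^ 2) (m + n)
    rw [h, one_pow] at h2
    rw [h2]
    have := Finset.single_le_sum (s := Finset.range (m + n + 1))
      (f := fun k => (α ^ 2) ^ k * (β ^ 2) ^ (m + n - k) * ((m + n).choose k : ℝ))
      (fun k _ => by positivity) (a := m) (by simp)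
    simpa using this
  have h3 : ((m + n).factorial : ℝ) = (m + n).choose m * m.factorial * n.factorial := by
    have := Nat.add_choose_mul_factorial_mul_factorial m n
    rw [← this, Nat.choose_symm_add]; push_cast; ring
  calc (sf (m + n) * α ^ m * β ^ n) ^ 2 = sf (m + n) ^ 2 * ((α ^ 2) ^ m * (β ^ 2) ^ n) := by ring
    _ = ((α ^ 2) ^ m * (β ^ 2) ^ n * ((m + n).choose m : ℝ)) * (m.factorial * n.factorial) := by
        rw [sf_sq, h3]; ring
    _ ≤ 1 * (m.factorial * n.factorial) := by gcongr
    _ = (sf m * sf n) ^ 2 := by rw [mul_pow, sf_sq, sf_sq, one_mul]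

theorem summable_lin_geom {r : ℝ} (h0 : 0 ≤ r) (h1 : r < 1) :
    Summable fun n : ℕ => ((n : ℝ) + 1) * r ^ n := by
  have h : ‖r‖ < 1 := by rwa [Real.norm_of_nonneg h0]
  have a := summable_pow_mul_geometric_of_norm_lt_one 1 h
  have b := summable_geometric_of_lt_one h0 h1
  refine (a.add b).congr fun n => ?_
  ring

theorem sqc_bound (a : ℕ → ℂ) {C q : ℝ} (hq : 0 ≤ q) (hC : 0 ≤ C)
    (h : ∀ n, ‖a n‖ * sf n ≤ C * q ^ n) (N : ℕ) :
    ‖sqc a N‖ * sf N ≤ (N + 1) * C ^ 2 * q ^ N * (Real.sqrt 2) ^ N := by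
  have hN := sf_pos N
  have h2 : (0 : ℝ) < Real.sqrt 2 := by positivity
  have hterm : ∀ kl ∈ Finset.HasAntidiagonal.antidiagonal N,
      ‖a kl.1 * a kl.2‖ ≤ C ^ 2 * q ^ N * (Real.sqrt 2) ^ N / sf N := by
    rintro ⟨k, l⟩ hkl
    obtain rfl : k + l = N := Finset.HasAntidiagonal.mem_antidiagonal.1 hkl
    have hk := sf_pos k
    have hl := sf_pos l
    have hb := sf_binom (α := (Real.sqrt 2)⁻¹) (β := (Real.sqrt 2)⁻¹) (by positivity)
      (by positivity) (by rw [inv_pow, Real.sq_sqrt (by norm_num)]; norm_num) k l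
    rw [norm_mul, le_div_iff₀ hN]
    have hb2 : sf (k + l) ≤ sf k * sf l * Real.sqrt 2 ^ (k + l) := by
      have : sf (k + l) * (Real.sqrt 2)⁻¹ ^ k * (Real.sqrt 2)⁻¹ ^ l =
        sf (k + l) / Real.sqrt 2 ^ (k + l) := by
        rw [inv_pow, inv_pow, pow_add]; field_simp
      rw [this, div_le_iff₀ (by positivity)] at hb
      exact hb
    calc ‖a k‖ * ‖a l‖ * sf (k + l) ≤ ‖a k‖ * ‖a l‖ * (sf k * sf l * Real.sqrt 2 ^ (k + l)) := by
          gcongr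
      _ = (‖a k‖ * sf k) * (‖a l‖ * sf l) * Real.sqrt 2 ^ (k + l) := by ring
      _ ≤ (C * q ^ k) * (C * q ^ l) * Real.sqrt 2 ^ (k + l) := by
          exact mul_le_mul_of_nonneg_right (mul_le_mul (h k) (h l) (by positivity) (by positivity))
            (by positivity)
      _ = _ := by ring
  have := norm_sum_le_of_le _ hterm
  rw [Finset.sum_const, Finset.Nat.card_antidiagonal, nsmul_eq_mul] at this
  rw [sqc, ← le_div_iff₀ hN]
  refine this.trans (le_of_eq ?_)
  push_cast; ring

theorem coeff_step (a : ℕ → ℂ) (L : ℕ → ℂ) {δ : ℝ} (hδ : 0 < δ) (n0 : ℕ)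
    (hL : ∀ n, n ≠ n0 → δ ≤ ‖L n‖)
    (hrel : ∀ n, HasSum (fun m => (starRingEnd ℂ) (a m) * sqc a (m + n) *
      (((m + n).factorial / (n.factorial * 2 ^ (m + n + 1)) : ℝ) : ℂ)) (L n * a n))
    {θ qs : ℝ} (hθ : 0 < θ) (hqs : 0 < qs) (hcond : 1 < θ ^ 2 * (2 - qs ^ 4)) :
    ∃ K : ℝ, 1 ≤ K ∧ ∀ C q : ℝ, 1 ≤ C → 0 ≤ q → q ≤ qs → (∀ n, ‖a n‖ * sf n ≤ C * q ^ n) →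
      ∀ n, ‖a n‖ * sf n ≤ K * C ^ 3 * (θ * q) ^ n := by
  obtain ⟨α, β, hα, hβ, hαβ, hρ, hτ⟩ : ∃ α β : ℝ, 0 < α ∧ 0 < β ∧ α ^ 2 + β ^ 2 = 1 ∧
      qs ^ 2 / (Real.sqrt 2 * α) < 1 ∧ 1 / (Real.sqrt 2 * β) < θ := by
    have hx : 0 < qs ^ 4 / 2 := by positivity
    have hxy : qs ^ 4 / 2 < 1 - 1 / (2 * θ ^ 2) := by
      have : 1 / (2 * θ ^ 2) < 1 - qs ^ 4 / 2 := by
        rw [div_lt_iff₀ (by positivity)]; nlinarith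
      linarith
    obtain ⟨y, hy1, hy2⟩ := exists_between hxy
    have hy0 : 0 < y := hx.trans hy1
    have h1 : 1 / (2 * θ ^ 2) < 1 - y := by linarith
    have h1y : 0 < 1 - y := lt_trans (by positivity) h1
    refine ⟨Real.sqrt y, Real.sqrt (1 - y), Real.sqrt_pos.2 hy0, Real.sqrt_pos.2 h1y, ?_, ?_, ?_⟩
    · rw [Real.sq_sqrt hy0.le, Real.sq_sqrt h1y.le]; ring
    · rw [div_lt_one (by positivity)]
      apply lt_of_pow_lt_pow_left₀ 2 (by positivity)
      rw [mul_pow, Real.sq_sqrt hy0.le, Real.sq_sqrt (by norm_num)]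
      nlinarith
    · rw [div_lt_iff₀ (by positivity)]
      apply lt_of_pow_lt_pow_left₀ 2 (by positivity)
      rw [mul_pow, mul_pow, Real.sq_sqrt h1y.le, Real.sq_sqrt (by norm_num)]
      rw [div_lt_iff₀ (by positivity)] at h1
      nlinarith
  set s2 := Real.sqrt 2 with hs2
  have hs2p : 0 < s2 := by positivity
  have hs2s : s2 ^ 2 = 2 := Real.sq_sqrt (by norm_num)
  set ρ := qs ^ 2 / (s2 * α) with hρd
  set τ := 1 / (s2 * β) with hτd
  have hρ0 : 0 ≤ ρ := by positivity
  have hτ0 : 0 ≤ τ := by positivity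
  have hS := summable_lin_geom hρ0 hρ
  set S := ∑' n : ℕ, ((n : ℝ) + 1) * ρ ^ n with hSd
  have hS0 : 0 ≤ S := tsum_nonneg fun n => by positivity
  have hT := summable_lin_geom (r := τ / θ) (by positivity) (by rwa [div_lt_one hθ])
  set T := ∑' n : ℕ, ((n : ℝ) + 1) * (τ / θ) ^ n with hTd
  have hT0 : 0 ≤ T := tsum_nonneg fun n => by positivity
  refine ⟨1 + T * S / δ + (θ ^ n0)⁻¹, ?_, ?_⟩
  · have : 0 ≤ T * S / δ := by positivity
    have : 0 ≤ (θ ^ n0)⁻¹ := by positivity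
    linarith
  intro C q hC hq hqq h n
  have hC0 : 0 < C := by linarith
  have hn := sf_pos n
  by_cases hnn : n = n0
  · subst hnn
    have h0 : 0 ≤ T * S / δ := by positivity
    have e1 : 1 ≤ (1 + T * S / δ + (θ ^ n)⁻¹) * θ ^ n := by
      have : (θ ^ n)⁻¹ * θ ^ n = 1 := inv_mul_cancel₀ (by positivity)
      have h3 : 0 ≤ (1 + T * S / δ) * θ ^ n := by positivity
      nlinarith
    have e2 : C ≤ C ^ 3 := by nlinarith [sq_nonneg C, mul_pos hC0 hC0]
    calc _ ≤ C * q ^ n := h n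
      _ ≤ C ^ 3 * q ^ n := by gcongr
      _ ≤ ((1 + T * S / δ + (θ ^ n)⁻¹) * θ ^ n) * (C ^ 3 * q ^ n) :=
          le_mul_of_one_le_left (by positivity) e1
      _ = _ := by rw [mul_pow]; ring
  · have hterm : ∀ m, ‖(starRingEnd ℂ) (a m) * sqc a (m + n) *
        (((m + n).factorial / (n.factorial * 2 ^ (m + n + 1)) : ℝ) : ℂ)‖ ≤
        (C ^ 3 * q ^ n * (n + 1) * τ ^ n / sf n) * (((m : ℝ) + 1) * ρ ^ m) := by
      intro m
      have hm := sf_pos m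
      have hN := sf_pos (m + n)
      have ha : ‖a m‖ ≤ C * q ^ m / sf m := by rw [le_div_iff₀ hm]; exact h m
      have hd : ‖sqc a (m + n)‖ ≤ ((m + n : ℕ) + 1) * C ^ 2 * q ^ (m + n) * s2 ^ (m + n) /
          sf (m + n) := by
        rw [le_div_iff₀ hN]; exact sqc_bound a hq hC0.le h (m + n)
      have hb : sf (m + n) / (sf m * sf n) ≤ 1 / (α ^ m * β ^ n) := by
        rw [div_le_div_iff₀ (by positivity) (by positivity)]
        have := sf_binom hα.le hβ.le hαβ m n
        nlinarith
      rw [norm_mul, norm_mul, RCLike.norm_conj, Complex.norm_real, Real.norm_of_nonneg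
        (by positivity), ← sf_sq, ← sf_sq n]
      have e2 : (2 : ℝ) ^ (m + n + 1) = 2 * (s2 ^ (m + n)) ^ 2 := by
        rw [← pow_mul, mul_comm (m + n) 2, pow_mul, hs2s]; ring
      calc ‖a m‖ * ‖sqc a (m + n)‖ * (sf (m + n) ^ 2 / (sf n ^ 2 * 2 ^ (m + n + 1)))
          ≤ (C * q ^ m / sf m) * (((m + n : ℕ) + 1) * C ^ 2 * q ^ (m + n) * s2 ^ (m + n) /
          sf (m + n)) * (sf (m + n) ^ 2 / (sf n ^ 2 * 2 ^ (m + n + 1))) := by gcongr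
        _ = (C ^ 3 * q ^ n * (q ^ 2) ^ m * (((m + n : ℕ) : ℝ) + 1) / 2 / s2 ^ (m + n) / sf n) *
            (sf (m + n) / (sf m * sf n)) := by
            rw [e2]; field_simp; ring
        _ ≤ (C ^ 3 * q ^ n * (qs ^ 2) ^ m * (((m : ℝ) + 1) * (n + 1)) / 1 / s2 ^ (m + n) / sf n) *
            (1 / (α ^ m * β ^ n)) := by
            gcongr
            · push_cast
              have : (0 : ℝ) ≤ (m : ℝ) * n := by positivity
              nlinarith
            · norm_num
        _ = _ := by
            rw [hρd, hτd, div_pow, div_pow, mul_pow, mul_pow, pow_add, one_pow]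
            field_simp
    have hnorm := tsum_of_norm_bounded (hS.hasSum.mul_left _) hterm
    rw [(hrel n).tsum_eq, ← hSd, norm_mul] at hnorm
    have h1 : δ * ‖a n‖ ≤ C ^ 3 * q ^ n * (n + 1) * τ ^ n / sf n * S :=
      (mul_le_mul_of_nonneg_right (hL n hnn) (norm_nonneg _)).trans hnorm
    have h2 : ((n : ℝ) + 1) * (τ / θ) ^ n ≤ T := hT.le_tsum n fun j _ => by positivity
    have h3 : ((n : ℝ) + 1) * τ ^ n ≤ T * θ ^ n := by
      rw [div_pow, ← mul_div_assoc, div_le_iff₀ (by positivity)] at h2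
      exact h2
    calc ‖a n‖ * sf n = (δ * ‖a n‖) * (sf n / δ) := by field_simp
      _ ≤ (C ^ 3 * q ^ n * (n + 1) * τ ^ n / sf n * S) * (sf n / δ) := by gcongr
      _ = (C ^ 3 * q ^ n * S / δ) * ((n + 1) * τ ^ n) := by field_simp
      _ ≤ (C ^ 3 * q ^ n * S / δ) * (T * θ ^ n) := by gcongr
      _ = (T * S / δ) * (C ^ 3 * (θ * q) ^ n) := by rw [mul_pow]; ring
      _ ≤ (1 + T * S / δ + (θ ^ n0)⁻¹) * (C ^ 3 * (θ * q) ^ n) := by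
          have : 0 ≤ (θ ^ n0)⁻¹ := by positivity
          gcongr
          linarith
      _ = _ := by ring

theorem coeff_init {f : ℂ → ℂ} (hf : Differentiable ℂ f) {C α : ℝ} (hα : α < 1 / 2)
    (hC : ∀ z, ‖f z‖ ≤ C * Real.exp (α * ‖z‖ ^ 2)) :
    ∃ C' q : ℝ, 1 ≤ C' ∧ 0 < q ∧ q < 1 ∧ ∀ n, ‖tc f n‖ * sf n ≤ C' * q ^ n := by
  obtain ⟨s, hs1, hs2⟩ : ∃ s : ℝ, max 0 (2 * α) < s ∧ s < 1 :=
    exists_between (max_lt (by norm_num) (by linarith))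
  have hs0 : 0 < s := (le_max_left _ _).trans_lt hs1
  have hsα : 2 * α < s := (le_max_right _ _).trans_lt hs1
  have hd : 0 < s - 2 * α := by linarith
  refine ⟨1 + Real.sqrt (C ^ 2 / (s - 2 * α)), Real.sqrt s, ?_, Real.sqrt_pos.2 hs0, ?_, ?_⟩
  · have := Real.sqrt_nonneg (C ^ 2 / (s - 2 * α)); linarith
  · rw [Real.sqrt_lt' one_pos]; simpa using hs2
  intro n
  have hint1 : Integrable (fun w : ℂ => ‖w‖ ^ (2 * n) * Real.exp (-s * ‖w‖ ^ 2)) := by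
    apply Integrable.of_integral_ne_zero
    rw [gauss_moment_diag hs0]
    positivity
  have hmono : ∫ w : ℂ, ‖tc f n‖ ^ 2 * (‖w‖ ^ (2 * n) * Real.exp (-s * ‖w‖ ^ 2)) ≤
      ∫ w : ℂ, C ^ 2 * Real.exp (-(s - 2 * α) * ‖w‖ ^ 2) := by
    refine integral_mono (hint1.const_mul _) ((gauss_integrable hd).const_mul _) fun w => ?_
    have h1 := pow_le_pow_left₀ (by positivity) (tc_bound hf hC n (norm_nonneg w)) 2
    calc ‖tc f n‖ ^ 2 * (‖w‖ ^ (2 * n) * Real.exp (-s * ‖w‖ ^ 2))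
        = (‖tc f n‖ * ‖w‖ ^ n) ^ 2 * Real.exp (-s * ‖w‖ ^ 2) := by ring
      _ ≤ (C * Real.exp (α * ‖w‖ ^ 2)) ^ 2 * Real.exp (-s * ‖w‖ ^ 2) := by gcongr
      _ = C ^ 2 * (Real.exp (α * ‖w‖ ^ 2) * Real.exp (α * ‖w‖ ^ 2) * Real.exp (-s * ‖w‖ ^ 2)) := by
          ring
      _ = _ := by rw [← Real.exp_add, ← Real.exp_add]; ring_nf
  rw [integral_const_mul, integral_const_mul, gauss_moment_diag hs0, gauss_integral hd] at hmono
  have hpi := Real.pi_pos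
  have h2 : ‖tc f n‖ ^ 2 * n.factorial ≤ C ^ 2 / (s - 2 * α) * s ^ n := by
    have h3 : ‖tc f n‖ ^ 2 * n.factorial ≤ C ^ 2 / (s - 2 * α) * s ^ (n + 1) := by
      have e1 : ‖tc f n‖ ^ 2 * (Real.pi * n.factorial / s ^ (n + 1)) =
        (‖tc f n‖ ^ 2 * n.factorial) * (Real.pi / s ^ (n + 1)) := by ring
      have e2 : C ^ 2 * (Real.pi / (s - 2 * α)) =
        (C ^ 2 / (s - 2 * α) * s ^ (n + 1)) * (Real.pi / s ^ (n + 1)) := by field_simp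
      rw [e1, e2] at hmono
      exact le_of_mul_le_mul_right hmono (by positivity)
    refine h3.trans ?_
    exact mul_le_mul_of_nonneg_left (pow_le_pow_of_le_one hs0.le hs2.le (Nat.le_succ n))
      (by positivity)
  have h4 : ‖tc f n‖ * sf n ≤ Real.sqrt (C ^ 2 / (s - 2 * α)) * Real.sqrt s ^ n := by
    have h5 := Real.sqrt_le_sqrt h2
    rw [Real.sqrt_mul (by positivity), Real.sqrt_sq (norm_nonneg _), Real.sqrt_mul (by positivity)]
      at h5
    have : Real.sqrt (s ^ n) = Real.sqrt s ^ n := by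
      rw [Real.sqrt_eq_iff_mul_self_eq (by positivity) (by positivity), ← mul_pow,
        Real.mul_self_sqrt hs0.le]
    rwa [this] at h5
  refine h4.trans ?_
  have : 0 ≤ Real.sqrt s ^ n := by positivity
  nlinarith

theorem coeff_iter (a : ℕ → ℂ) (L : ℕ → ℂ) {δ : ℝ} (hδ : 0 < δ) (n0 : ℕ)
    (hL : ∀ n, n ≠ n0 → δ ≤ ‖L n‖)
    (hrel : ∀ n, HasSum (fun m => (starRingEnd ℂ) (a m) * sqc a (m + n) *
      (((m + n).factorial / (n.factorial * 2 ^ (m + n + 1)) : ℝ) : ℂ)) (L n * a n))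
    {C0 q0 : ℝ} (hC0 : 1 ≤ C0) (hq0 : 0 < q0) (hq1 : q0 < 1)
    (h0 : ∀ n, ‖a n‖ * sf n ≤ C0 * q0 ^ n)
    {θ : ℝ} (hθ : 0 < θ) (hθ2 : 1 < 2 * θ ^ 2) :
    ∃ B : ℝ, 1 ≤ B ∧ ∀ j n : ℕ, ‖a n‖ * sf n ≤ B ^ (3 ^ j) * (θ ^ j) ^ n := by
  -- choose the target radius
  obtain ⟨qs, hqs0, hqs1, hcond⟩ : ∃ qs : ℝ, 0 < qs ∧ qs < 1 ∧ 1 < θ ^ 2 * (2 - qs ^ 4) := by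
    have hd : 0 < (2 * θ ^ 2 - 1) / (θ ^ 2 + (2 * θ ^ 2 - 1)) := by
      apply div_pos <;> nlinarith
    have hd1 : (2 * θ ^ 2 - 1) / (θ ^ 2 + (2 * θ ^ 2 - 1)) < 1 := by
      rw [div_lt_one (by nlinarith)]; nlinarith
    set t := (2 * θ ^ 2 - 1) / (θ ^ 2 + (2 * θ ^ 2 - 1)) with ht
    have ht2 : t * (θ ^ 2 + (2 * θ ^ 2 - 1)) = 2 * θ ^ 2 - 1 := by
      rw [ht, div_mul_cancel₀]; nlinarith
    refine ⟨t, hd, hd1, ?_⟩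
    have h4 : t ^ 4 ≤ t := by
      calc t ^ 4 ≤ t ^ 1 := pow_le_pow_of_le_one hd.le hd1.le (by norm_num)
        _ = t := pow_one t
    have h5 : θ ^ 2 * t ^ 4 ≤ θ ^ 2 * t := by gcongr
    have h6 : 0 < t * (2 * θ ^ 2 - 1) := by apply mul_pos hd; linarith
    nlinarith
  obtain ⟨θ0, hθ00, hθ01, hcond0⟩ : ∃ θ0 : ℝ, 0 < θ0 ∧ θ0 < 1 ∧ 1 < θ0 ^ 2 * (2 - q0 ^ 4) := by
    have h4 : q0 ^ 4 < 1 := pow_lt_one₀ hq0.le hq1 (by norm_num)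
    have h5 : 0 < 2 - q0 ^ 4 := by linarith
    obtain ⟨y, hy1, hy2⟩ := exists_between (a₁ := 1 / (2 - q0 ^ 4)) (a₂ := 1) (by
      rw [div_lt_one h5]; linarith)
    have hy0 : 0 < y := lt_trans (by positivity) hy1
    refine ⟨Real.sqrt y, Real.sqrt_pos.2 hy0, ?_, ?_⟩
    · rw [Real.sqrt_lt' one_pos]; simpa using hy2
    · rw [Real.sq_sqrt hy0.le]; rwa [div_lt_iff₀ h5] at hy1
  obtain ⟨K0, hK0, hstep0⟩ := coeff_step a L hδ n0 hL hrel hθ00 hq0 hcond0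
  obtain ⟨K, hK, hstep⟩ := coeff_step a L hδ n0 hL hrel hθ hqs0 hcond
  have ph1 : ∀ j : ℕ, ∃ C : ℝ, 1 ≤ C ∧ ∀ n, ‖a n‖ * sf n ≤ C * (θ0 ^ j * q0) ^ n := by
    intro j
    induction j with
    | zero => exact ⟨C0, hC0, by simpa using h0⟩
    | succ j ih =>
      obtain ⟨C, hC, hb⟩ := ih
      have hp : θ0 ^ j ≤ 1 := pow_le_one₀ hθ00.le hθ01.le
      refine ⟨K0 * C ^ 3, ?_, ?_⟩
      · have : 1 ≤ C ^ 3 := one_le_pow₀ hC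
        nlinarith
      · have := hstep0 C (θ0 ^ j * q0) hC (by positivity) (by nlinarith) hb
        intro n
        have h := this n
        rwa [← mul_assoc θ0, ← pow_succ'] at h
  obtain ⟨j0, hj0⟩ := exists_pow_lt_of_lt_one hqs0 hθ01
  obtain ⟨C1, hC1, hb1⟩ := ph1 j0
  have hb2 : ∀ n, ‖a n‖ * sf n ≤ C1 * qs ^ n := fun n => (hb1 n).trans (by
    have : θ0 ^ j0 * q0 ≤ qs := by
      have : 0 < θ0 ^ j0 := by positivity
      nlinarith
    gcongr)
  -- we may assume θ ≤ 1 is not needed: use min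
  have ph2 : ∀ j : ℕ, ∃ C : ℝ, 1 ≤ C ∧ C * K ≤ (C1 * K) ^ (3 ^ j) ∧
      ((θ < 1) → ∀ n, ‖a n‖ * sf n ≤ C * (θ ^ j * qs) ^ n) := by
    intro j
    induction j with
    | zero => exact ⟨C1, hC1, by simp, fun _ => by simpa using hb2⟩
    | succ j ih =>
      obtain ⟨C, hC, hCK, hb⟩ := ih
      refine ⟨K * C ^ 3, ?_, ?_, ?_⟩
      · have : 1 ≤ C ^ 3 := one_le_pow₀ hC
        nlinarith
      · have h1 := pow_le_pow_left₀ (by positivity) hCK 3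
        rw [← pow_mul, ← pow_succ] at h1
        refine le_trans ?_ h1
        have h3 : 0 < C ^ 3 * K ^ 2 := by positivity
        calc K * C ^ 3 * K = (C ^ 3 * K ^ 2) * 1 := by ring
          _ ≤ (C ^ 3 * K ^ 2) * K := by gcongr
          _ = _ := by ring
      · intro h1 n
        have hp : θ ^ j ≤ 1 := pow_le_one₀ hθ.le h1.le
        have h := hstep C (θ ^ j * qs) hC (by positivity) (by nlinarith) (hb h1) n
        rwa [← mul_assoc θ, ← pow_succ'] at h
  refine ⟨C1 * K, by nlinarith, fun j n => ?_⟩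
  by_cases h1 : θ < 1
  · obtain ⟨C, hC, hCK, hb⟩ := ph2 j
    have hp : 0 < θ ^ j := by positivity
    refine (hb h1 n).trans ?_
    have : C ≤ (C1 * K) ^ (3 ^ j) := by nlinarith
    gcongr
    nlinarith
  · have hp : 1 ≤ (θ ^ j) ^ n := one_le_pow₀ (one_le_pow₀ (not_lt.1 h1))
    have hB : 1 ≤ C1 * K := by nlinarith
    have hB3 : C1 * K ≤ (C1 * K) ^ (3 ^ j) := le_self_pow₀ hB (by positivity)
    have hq : qs ^ n ≤ 1 := pow_le_one₀ hqs0.le hqs1.le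
    calc ‖a n‖ * sf n ≤ C1 * qs ^ n := hb2 n
      _ ≤ C1 := by nlinarith
      _ ≤ C1 * K := by nlinarith
      _ ≤ (C1 * K) ^ (3 ^ j) := hB3
      _ ≤ _ := le_mul_of_one_le_right (by positivity) hp

theorem coeff_final (a : ℕ → ℂ) {B σ : ℝ} (hB : 1 ≤ B) (hσ : 0 ≤ σ)
    (h : ∀ j n : ℕ, ‖a n‖ * sf n ≤ B ^ (3 ^ j) * (((3 : ℝ) ^ (-σ)) ^ j) ^ n) :
    ∃ B' : ℝ, 1 ≤ B' ∧ ∀ n : ℕ, ‖a n‖ ≤ B' ^ (n + 1) * ((n : ℝ) ^ (-(1 / 2 + σ))) ^ n := by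
  have h3 : (1 : ℝ) ≤ 3 ^ σ := Real.one_le_rpow (by norm_num) hσ
  have he : (1 : ℝ) ≤ Real.exp (1 / 2) := Real.one_le_exp (by norm_num)
  refine ⟨B * (3 ^ σ * Real.exp (1 / 2)), ?_, fun n => ?_⟩
  · have : 1 ≤ (3 : ℝ) ^ σ * Real.exp (1 / 2) := one_le_mul_of_one_le_of_one_le h3 he
    nlinarith
  have hD : (1 : ℝ) ≤ 3 ^ σ * Real.exp (1 / 2) := one_le_mul_of_one_le_of_one_le h3 he
  rcases Nat.eq_zero_or_pos n with rfl | hn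
  · have := h 0 0
    simp [sf] at this ⊢
    nlinarith
  have hn' : (0 : ℝ) < n := by exact_mod_cast hn
  set j := Nat.log 3 n with hj
  have hj1 : 3 ^ j ≤ n := Nat.pow_log_le_self 3 hn.ne'
  have hj2 : n < 3 ^ (j + 1) := Nat.lt_pow_succ_log_self (by norm_num) n
  have hsf := sf_pos n
  -- lower bound for sf
  have hlow : ((n : ℝ) ^ (1 / 2 : ℝ)) ^ n ≤ sf n * Real.exp (1 / 2) ^ n := by
    have h1 := Real.pow_div_factorial_le_exp (n : ℝ) hn'.le n
    rw [div_le_iff₀ (by positivity)] at h1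
    have h2 : (((n : ℝ) ^ (1 / 2 : ℝ)) ^ n) ^ 2 = (n : ℝ) ^ n := by
      rw [← pow_mul, mul_comm n 2, pow_mul, ← Real.sqrt_eq_rpow, Real.sq_sqrt hn'.le]
    have h4 : (sf n * Real.exp (1 / 2) ^ n) ^ 2 = Real.exp n * n.factorial := by
      rw [mul_pow, sf_sq, ← pow_mul, ← Real.exp_nat_mul]
      push_cast
      rw [mul_comm]
      congr 2
      ring
    refine le_of_not_gt fun hlt => absurd (pow_lt_pow_left₀ hlt (by positivity) two_ne_zero)
      (not_lt.2 ?_)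
    rw [h2, h4]; exact h1
  have hth : ((3 : ℝ) ^ (-σ)) ^ j ≤ 3 ^ σ * (n : ℝ) ^ (-σ) := by
    have h1 : ((3 : ℝ) ^ (j + 1)) ^ (-σ) ≤ (n : ℝ) ^ (-σ) := by
      apply Real.rpow_le_rpow_of_nonpos hn' _ (by linarith)
      exact_mod_cast hj2.le
    have h2 : ((3 : ℝ) ^ (j + 1)) ^ (-σ) = ((3 : ℝ) ^ (-σ)) ^ j * 3 ^ (-σ) := by
      rw [← Real.rpow_natCast, ← Real.rpow_mul (by norm_num), mul_comm,
        Real.rpow_mul (by norm_num), Real.rpow_natCast, pow_succ]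
    have h5 : (3 : ℝ) ^ σ * 3 ^ (-σ) = 1 := by
      rw [← Real.rpow_add (by norm_num)]; simp
    calc ((3 : ℝ) ^ (-σ)) ^ j = 3 ^ σ * (((3 : ℝ) ^ (-σ)) ^ j * 3 ^ (-σ)) := by
          rw [mul_left_comm, h5, mul_one]
      _ ≤ _ := by rw [← h2]; gcongr
  have hsplit : (n : ℝ) ^ (-(1 / 2 + σ)) = (n : ℝ) ^ (-σ) / (n : ℝ) ^ (1 / 2 : ℝ) := by
    rw [← Real.rpow_sub hn']; ring_nf
  have hhalf : 0 < (n : ℝ) ^ (1 / 2 : ℝ) := by positivity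
  have hmain := h j n
  have hB2 : B ^ (3 ^ j) ≤ B ^ (n + 1) := pow_le_pow_right₀ hB (by omega)
  have hA : ‖a n‖ * sf n ≤ B ^ (n + 1) * (3 ^ σ * (n : ℝ) ^ (-σ)) ^ n :=
    hmain.trans (by gcongr)
  rw [hsplit, div_pow, mul_div_assoc', le_div_iff₀ (by positivity)]
  calc ‖a n‖ * ((n : ℝ) ^ (1 / 2 : ℝ)) ^ n ≤ ‖a n‖ * (sf n * Real.exp (1 / 2) ^ n) := by gcongr
    _ = (‖a n‖ * sf n) * Real.exp (1 / 2) ^ n := by ring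
    _ ≤ (B ^ (n + 1) * (3 ^ σ * (n : ℝ) ^ (-σ)) ^ n) * Real.exp (1 / 2) ^ n := by gcongr
    _ = B ^ (n + 1) * (3 ^ σ * Real.exp (1 / 2)) ^ n * ((n : ℝ) ^ (-σ)) ^ n := by
        rw [mul_pow, mul_pow]; ring
    _ ≤ B ^ (n + 1) * (3 ^ σ * Real.exp (1 / 2)) ^ (n + 1) * ((n : ℝ) ^ (-σ)) ^ n := by
        gcongr
        omega
    _ = _ := by rw [mul_pow B]

theorem growth_of_coeff {f : ℂ → ℂ} (a : ℕ → ℂ) (hs : ∀ z, HasSum (fun n => a n * z ^ n) (f z))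
    {B γ : ℝ} (hB : 1 ≤ B) (hγ : 0 < γ)
    (h : ∀ n : ℕ, ‖a n‖ ≤ B ^ (n + 1) * ((n : ℝ) ^ (-γ)) ^ n) (z : ℂ) {X : ℝ} (hX : 1 ≤ X)
    (hzX : 2 * B * ‖z‖ ≤ X) :
    ‖f z‖ ≤ 2 * B * Real.exp (X ^ (1 / γ) * Real.log X) := by
  have hX0 : 0 < X := by linarith
  have hlog : 0 ≤ Real.log X := Real.log_nonneg hX
  set E := Real.exp (X ^ (1 / γ) * Real.log X) with hE
  have hE1 : 1 ≤ E := Real.one_le_exp (by positivity)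
  have hterm : ∀ n, ‖a n * z ^ n‖ ≤ (B * E) * (1 / 2) ^ n := by
    intro n
    rw [norm_mul, norm_pow]
    have h1 : ‖a n‖ * ‖z‖ ^ n ≤ B * (X * (n : ℝ) ^ (-γ)) ^ n * (1 / 2) ^ n := by
      calc ‖a n‖ * ‖z‖ ^ n ≤ (B ^ (n + 1) * ((n : ℝ) ^ (-γ)) ^ n) * ‖z‖ ^ n := by
            gcongr; exact h n
        _ = B * ((2 * B * ‖z‖) * (n : ℝ) ^ (-γ)) ^ n * (1 / 2) ^ n := by
            rw [mul_assoc, mul_assoc, ← mul_pow, ← mul_pow,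
              pow_succ]
            rw [show 2 * B * ‖z‖ * (n : ℝ) ^ (-γ) * (1 / 2) = B * ((n : ℝ) ^ (-γ) * ‖z‖) by ring,
              mul_pow B]
            ring
        _ ≤ _ := by gcongr
    refine h1.trans ?_
    gcongr
    rcases Nat.eq_zero_or_pos n with rfl | hn
    · simpa using hE1
    have hn' : (1 : ℝ) ≤ n := by exact_mod_cast hn
    have hn0 : (0 : ℝ) < n := by linarith
    by_cases hc : (n : ℝ) ≤ X ^ (1 / γ)
    · have h2 : (n : ℝ) ^ (-γ) ≤ 1 := Real.rpow_le_one_of_one_le_of_nonpos hn' (by linarith)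
      calc (X * (n : ℝ) ^ (-γ)) ^ n ≤ (X * 1) ^ n := by gcongr
        _ = Real.exp (n * Real.log X) := by
            rw [mul_one, Real.exp_nat_mul, Real.exp_log hX0]
        _ ≤ E := Real.exp_le_exp.2 (mul_le_mul_of_nonneg_right hc hlog)
    · refine le_trans (pow_le_one₀ (by positivity) ?_) hE1
      rw [Real.rpow_neg hn0.le, ← div_eq_mul_inv, div_le_one (by positivity)]
      have h3 := Real.rpow_le_rpow (by positivity) (not_le.1 hc).le hγ.le
      rwa [← Real.rpow_mul hX0.le, one_div_mul_cancel hγ.ne', Real.rpow_one] at h3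
  have := tsum_of_norm_bounded ((hasSum_geometric_two).mul_left (B * E)) hterm
  rw [(hs z).tsum_eq] at this
  linarith

theorem zero_count_aux (p : ℂ) {R : ℝ} (hR : 0 < R) (s : Finset ℂ) :
    ∀ (f : ℂ → ℂ), Differentiable ℂ f → ∀ Mx : ℝ, (∀ a ∈ s, f a = 0) →
      (∀ a ∈ s, ‖a - p‖ ≤ R) → (∀ z, ‖z - p‖ ≤ 4 * R → ‖f z‖ ≤ Mx) →
      3 ^ s.card * ‖f p‖ ≤ Mx := by
  classical
  induction s using Finset.induction_on with
  | empty =>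
    intro f _ Mx _ _ h
    simpa using h p (by simp; positivity)
  | insert a t hat ih =>
    intro f hf Mx hz hb hM
    have hfa : f a = 0 := hz a (Finset.mem_insert_self _ _)
    have hap : ‖a - p‖ ≤ R := hb a (Finset.mem_insert_self _ _)
    set g := dslope f a with hg
    have hgd : Differentiable ℂ g := by
      have := (Complex.differentiableOn_dslope (f := f) (s := Set.univ) (c := a)
        Filter.univ_mem).2 hf.differentiableOn
      exact differentiableOn_univ.1 this
    have hfg : ∀ z, f z = (z - a) * g z := by
      intro z
      have := sub_smul_dslope f a z
      rw [hfa, sub_zero, smul_eq_mul] at this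
      exact this.symm
    have hgM : ∀ z, ‖z - p‖ ≤ 4 * R → ‖g z‖ ≤ Mx / (3 * R) := by
      intro z hzz
      refine Complex.norm_le_of_forall_mem_frontier_norm_le (U := Metric.ball p (4 * R))
        Metric.isBounded_ball hgd.diffContOnCl ?_ ?_
      · intro w hw
        rw [frontier_ball p (by positivity)] at hw
        rw [mem_sphere_iff_norm] at hw
        have h1 := hM w hw.le
        rw [hfg, norm_mul] at h1
        have h2 : 3 * R ≤ ‖w - a‖ := by
          have : ‖w - p‖ ≤ ‖w - a‖ + ‖a - p‖ := by
            have := norm_add_le (w - a) (a - p)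
            simpa using this
          linarith
        rw [le_div_iff₀ (by positivity)]
        nlinarith [norm_nonneg (g w)]
      · rw [closure_ball p (by positivity), mem_closedBall_iff_norm]; exact hzz
    have hgz : ∀ b ∈ t, g b = 0 := by
      intro b hbt
      have h1 := hz b (Finset.mem_insert_of_mem hbt)
      rw [hfg] at h1
      rcases mul_eq_zero.1 h1 with h2 | h2
      · exact absurd (sub_eq_zero.1 h2 ▸ hbt) hat
      · exact h2
    have h3 := ih g hgd (Mx / (3 * R)) hgz (fun b hbt => hb b (Finset.mem_insert_of_mem hbt)) hgM
    rw [Finset.card_insert_of_notMem hat, hfg p, norm_mul, norm_sub_rev, pow_succ]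
    rw [le_div_iff₀ (by positivity)] at h3
    have h4 : 0 ≤ 3 ^ t.card * ‖g p‖ := by positivity
    calc 3 ^ t.card * 3 * (‖a - p‖ * ‖g p‖) = (3 ^ t.card * ‖g p‖) * (3 * ‖a - p‖) := by ring
      _ ≤ (3 ^ t.card * ‖g p‖) * (3 * R) := by gcongr
      _ ≤ Mx := h3

theorem zero_count_growth {f : ℂ → ℂ} (hf : Differentiable ℂ f) (hf0 : ∃ z, f z ≠ 0)
    {C ρ η : ℝ} (hC : 0 < C) (hρ : 0 < ρ) (hρη : ρ < η)
    (hgr : ∀ z, ‖f z‖ ≤ C * Real.exp (C * (1 + ‖z‖) ^ ρ)) :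
    Filter.Tendsto (fun R : ℝ => (({z : ℂ | f z = 0 ∧ ‖z‖ < R}.ncard : ℝ) / R ^ η))
      Filter.atTop (nhds 0) := by
  obtain ⟨p, hp⟩ := hf0
  have hfp : 0 < ‖f p‖ := norm_pos_iff.2 hp
  set c := 6 + 6 * ‖p‖ with hc
  have hc0 : 0 < c := by positivity
  have hbound : ∀ R : ℝ, 1 ≤ R → ({z : ℂ | f z = 0 ∧ ‖z‖ < R}.ncard : ℝ) ≤
      |Real.log (C / ‖f p‖)| + C * c ^ ρ * R ^ ρ := by
    intro R hR
    have hR0 : 0 < R := by linarith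
    by_cases hfin : {z : ℂ | f z = 0 ∧ ‖z‖ < R}.Finite
    · rw [Set.ncard_eq_toFinset_card _ hfin]
      set s := hfin.toFinset with hs
      have h1 := zero_count_aux p (R := R + ‖p‖) (by positivity) s f hf
        (C * Real.exp (C * (c * R) ^ ρ)) ?_ ?_ ?_
      · have h2 : (3 : ℝ) ^ s.card ≤ C / ‖f p‖ * Real.exp (C * (c * R) ^ ρ) := by
          rw [div_mul_eq_mul_div, le_div_iff₀ hfp]; exact h1
        have h3 := Real.log_le_log (by positivity) h2
        rw [Real.log_mul (by positivity) (by positivity), Real.log_exp, Real.log_pow,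
          Real.mul_rpow hc0.le hR0.le] at h3
        have h4 : 1 ≤ Real.log 3 := by
          rw [Real.le_log_iff_exp_le (by norm_num)]
          linarith [Real.exp_one_lt_d9]
        have h5 : (s.card : ℝ) ≤ s.card * Real.log 3 := le_mul_of_one_le_right (by positivity) h4
        have h6 := le_abs_self (Real.log (C / ‖f p‖))
        linarith
      · intro a ha; rw [hs, Set.Finite.mem_toFinset] at ha; exact ha.1
      · intro a ha; rw [hs, Set.Finite.mem_toFinset] at ha
        exact (norm_sub_le _ _).trans (by linarith [ha.2])
      · intro z hz
        refine (hgr z).trans ?_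
        have h7 : ‖z‖ ≤ ‖z - p‖ + ‖p‖ := by
          have := norm_add_le (z - p) p
          simpa using this
        have h8 : 1 + ‖z‖ ≤ c * R := by
          rw [hc]
          nlinarith [norm_nonneg p]
        gcongr
    · rw [Set.Infinite.ncard hfin]
      simp only [Nat.cast_zero]
      positivity
  have hlim : Filter.Tendsto (fun R : ℝ => |Real.log (C / ‖f p‖)| * R ^ (-η) +
      C * c ^ ρ * R ^ (-(η - ρ))) Filter.atTop (nhds 0) := by
    have h1 := (tendsto_rpow_neg_atTop (y := η) (by linarith)).const_mul |Real.log (C / ‖f p‖)|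
    have h2 := (tendsto_rpow_neg_atTop (y := η - ρ) (by linarith)).const_mul (C * c ^ ρ)
    simpa using h1.add h2
  refine squeeze_zero' ?_ ?_ hlim
  · filter_upwards [Filter.eventually_ge_atTop 0] with R hR
    positivity
  · filter_upwards [Filter.eventually_ge_atTop 1] with R hR
    have hR0 : 0 < R := by linarith
    calc _ ≤ (|Real.log (C / ‖f p‖)| + C * c ^ ρ * R ^ ρ) / R ^ η := by
          gcongr; exact hbound R hR
      _ = _ := by
          rw [show -(η - ρ) = ρ - η by ring, Real.rpow_sub hR0, Real.rpow_neg hR0.le]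
          field_simp

/-- Zero counting once the coefficients satisfy the recursion and `f` has Gaussian decay. -/
theorem zero_count_of_gauss {f : ℂ → ℂ} (hf : Differentiable ℂ f) (hf0 : ∃ z, f z ≠ 0)
    {C α : ℝ} (hα : α < 1 / 2)
    (hC : ∀ z, ‖f z‖ ≤ C * Real.exp (α * ‖z‖ ^ 2)) (lam mu : ℝ) (hlm : lam ≠ 0 ∨ mu ≠ 0)
    (hrel : ∀ n : ℕ, HasSum (fun m => (starRingEnd ℂ) (tc f m) * sqc (tc f) (m + n) *
      (((m + n).factorial / (n.factorial * 2 ^ (m + n + 1)) : ℝ) : ℂ))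
      (((lam : ℂ) + mu * n) * tc f n))
    {η : ℝ} (hη : η > (1 / 2 + (1 / 2) * (Real.log 2 / Real.log 3))⁻¹) :
    Filter.Tendsto (fun R : ℝ => (({z : ℂ | f z = 0 ∧ ‖z‖ < R}.ncard : ℝ) / R ^ η))
      Filter.atTop (nhds 0) := by
  obtain ⟨C0, q0, hC0, hq0, hq1, h0⟩ := coeff_init hf hα hC
  -- lower bound on the multiplier
  obtain ⟨δ, n0, hδ, hL⟩ : ∃ (δ : ℝ) (n0 : ℕ), 0 < δ ∧
      ∀ n : ℕ, n ≠ n0 → δ ≤ ‖(lam : ℂ) + mu * n‖ := by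
    have hcast : ∀ n : ℕ, ‖(lam : ℂ) + mu * n‖ = |lam + mu * n| := by
      intro n
      rw [← Real.norm_eq_abs, ← Complex.norm_real]; push_cast; rfl
    simp_rw [hcast]
    by_cases hmu : mu = 0
    · refine ⟨|lam|, 0, abs_pos.2 (by tauto), fun n _ => ?_⟩
      simp [hmu]
    · by_cases hclose : ∃ n0 : ℕ, |lam + mu * n0| < |mu| / 2
      · obtain ⟨n0, hn0⟩ := hclose
        refine ⟨|mu| / 2, n0, by positivity, fun n hn => ?_⟩
        have h1 : |mu| ≤ |mu * ((n : ℝ) - n0)| := by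
          rw [abs_mul]
          have : (1 : ℝ) ≤ |(n : ℝ) - n0| := by
            have : (1 : ℤ) ≤ |(n : ℤ) - n0| := Int.one_le_abs (by omega)
            exact_mod_cast this
          nlinarith [abs_nonneg mu]
        have h2 : |mu * ((n : ℝ) - n0)| ≤ |lam + mu * n| + |lam + mu * n0| := by
          have := abs_sub (lam + mu * n) (lam + mu * n0)
          rwa [show lam + mu * n - (lam + mu * n0) = mu * ((n : ℝ) - n0) by ring] at this
        linarith
      · push Not at hclose
        exact ⟨|mu| / 2, 0, by positivity, fun n _ => hclose n⟩
  have hl2 : 0 < Real.log 2 := Real.log_pos (by norm_num)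
  have hl3 : 0 < Real.log 3 := Real.log_pos (by norm_num)
  have hη0 : 0 < η := lt_trans (by positivity) hη
  have hη1 : 1 / η - 1 / 2 < 1 / 2 * (Real.log 2 / Real.log 3) := by
    have := inv_lt_of_inv_lt₀ (by positivity) hη
    rw [one_div]; linarith
  obtain ⟨σ, hσ1, hσ2⟩ := exists_between (max_lt (show (0 : ℝ) < 1 / 2 * (Real.log 2 / Real.log 3)
    by positivity) hη1)
  have hσ0 : 0 < σ := (le_max_left _ _).trans_lt hσ1
  have hση : 1 / η < 1 / 2 + σ := by linarith [(le_max_right 0 (1 / η - 1 / 2)).trans_lt hσ1]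
  have hθ : 1 < 2 * ((3 : ℝ) ^ (-σ)) ^ 2 := by
    have h1 : 2 * σ * Real.log 3 < Real.log 2 := by
      rw [← mul_div_assoc, lt_div_iff₀ hl3] at hσ2
      linarith
    have h2 : (2 : ℝ) * ((3 : ℝ) ^ (-σ)) ^ 2 = Real.exp (Real.log 2 - 2 * σ * Real.log 3) := by
      rw [Real.exp_sub, Real.exp_log (by norm_num), Real.rpow_def_of_pos (by norm_num),
        ← Real.exp_nat_mul, div_eq_mul_inv, ← Real.exp_neg]
      congr 2
      push_cast; ring
    rw [h2]
    exact Real.one_lt_exp_iff.2 (by linarith)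
  obtain ⟨B, hB, hit⟩ := coeff_iter (tc f) (fun n => (lam : ℂ) + mu * n) hδ n0 hL hrel hC0 hq0 hq1
    h0 (θ := (3 : ℝ) ^ (-σ)) (by positivity) hθ
  obtain ⟨B', hB', hfin⟩ := coeff_final (tc f) hB hσ0.le hit
  have hγ : 0 < 1 / 2 + σ := by positivity
  set ρ0 := 1 / (1 / 2 + σ) with hρ0
  have hρ0p : 0 < ρ0 := by positivity
  have hρη : ρ0 < η := by
    rw [hρ0, div_lt_iff₀ hγ]
    rw [div_lt_iff₀ hη0] at hση
    linarith
  set ε := (η - ρ0) / 2 with hε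
  have hε0 : 0 < ε := by rw [hε]; linarith
  have hD : 0 < (2 * B') ^ (ρ0 + ε) / ε := by positivity
  refine zero_count_growth hf hf0 (C := 2 * B' + (2 * B') ^ (ρ0 + ε) / ε) (ρ := ρ0 + ε)
    (by positivity) (by positivity) (by rw [hε]; linarith) fun z => ?_
  have hz1 : 1 ≤ 1 + ‖z‖ := by linarith [norm_nonneg z]
  have hX1 : 1 ≤ 2 * B' * (1 + ‖z‖) := by nlinarith
  have hX0 : 0 < 2 * B' * (1 + ‖z‖) := by positivity
  have h1 := growth_of_coeff (tc f) (tc_hasSum hf) hB' hγ hfin z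
    (X := 2 * B' * (1 + ‖z‖)) hX1 (by nlinarith)
  refine h1.trans ?_
  have h2 : (2 * B' * (1 + ‖z‖)) ^ ρ0 * Real.log (2 * B' * (1 + ‖z‖)) ≤
      (2 * B') ^ (ρ0 + ε) / ε * (1 + ‖z‖) ^ (ρ0 + ε) := by
    have h3 := Real.log_le_rpow_div hX0.le hε0
    calc _ ≤ (2 * B' * (1 + ‖z‖)) ^ ρ0 * ((2 * B' * (1 + ‖z‖)) ^ ε / ε) := by gcongr
      _ = (2 * B' * (1 + ‖z‖)) ^ (ρ0 + ε) / ε := by rw [Real.rpow_add hX0]; ring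
      _ = _ := by rw [Real.mul_rpow (by positivity) (by positivity)]; ring
  have h4 : (2 * B') ^ (ρ0 + ε) / ε * (1 + ‖z‖) ^ (ρ0 + ε) ≤
      (2 * B' + (2 * B') ^ (ρ0 + ε) / ε) * (1 + ‖z‖) ^ (ρ0 + ε) := by
    gcongr; linarith
  calc _ ≤ 2 * B' * Real.exp ((2 * B' + (2 * B') ^ (ρ0 + ε) / ε) * (1 + ‖z‖) ^ (ρ0 + ε)) := by
        exact mul_le_mul_of_nonneg_left (Real.exp_le_exp.2 (h2.trans h4)) (by positivity)
    _ ≤ _ := by gcongr; linarith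

theorem kernel_bound {f g : ℂ → ℂ}
    (heq : ∀ z, g z = (Real.pi : ℂ)⁻¹ * ∫ w : ℂ, Complex.exp ((starRingEnd ℂ) w * z) *
      (((starRingEnd ℂ) (f w)) * f w ^ 2 * (Real.exp (-2 * ‖w‖ ^ 2) : ℂ)))
    {κ S T : ℝ} (hκ : 0 ≤ κ) (hS : 0 ≤ S) (hT : 0 ≤ T)
    (h : ∀ w, (‖f w‖ * Real.exp (-‖w‖ ^ 2 / 2)) ^ 3 ≤ S * Real.exp (-κ * ‖w‖) + T) (z : ℂ) :
    ‖g z‖ ≤ (4 * Real.exp (κ ^ 2) * S * Real.exp (-κ * ‖z‖) + 4 * T) * Real.exp (‖z‖ ^ 2 / 2) := by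
  set D := Real.exp (κ ^ 2) * S * Real.exp (-κ * ‖z‖) + T with hD
  have hD0 : 0 ≤ D := by positivity
  have hpt : ∀ w : ℂ, ‖Complex.exp ((starRingEnd ℂ) w * z) *
      (((starRingEnd ℂ) (f w)) * f w ^ 2 * (Real.exp (-2 * ‖w‖ ^ 2) : ℂ))‖ ≤
      (Real.exp (‖z‖ ^ 2 / 2) * D) * Real.exp (-(1 / 4) * ‖w - z‖ ^ 2) := by
    intro w
    have hexp : ((starRingEnd ℂ) w * z).re = ‖z‖ ^ 2 / 2 + ‖w‖ ^ 2 / 2 - ‖w - z‖ ^ 2 / 2 := by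
      rw [Complex.sq_norm, Complex.sq_norm, Complex.sq_norm, Complex.normSq_apply,
        Complex.normSq_apply, Complex.normSq_apply]
      simp
      ring
    rw [norm_mul, norm_mul, norm_mul, norm_pow, RCLike.norm_conj, Complex.norm_exp, hexp,
      Complex.norm_real, Real.norm_of_nonneg (Real.exp_pos _).le]
    have e1 : Real.exp (‖z‖ ^ 2 / 2 + ‖w‖ ^ 2 / 2 - ‖w - z‖ ^ 2 / 2) *
        (‖f w‖ * ‖f w‖ ^ 2 * Real.exp (-2 * ‖w‖ ^ 2)) =
        Real.exp (‖z‖ ^ 2 / 2) * Real.exp (-‖w - z‖ ^ 2 / 2) *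
          (‖f w‖ * Real.exp (-‖w‖ ^ 2 / 2)) ^ 3 := by
      rw [mul_pow, ← Real.exp_nat_mul]
      have : Real.exp (‖z‖ ^ 2 / 2 + ‖w‖ ^ 2 / 2 - ‖w - z‖ ^ 2 / 2) * Real.exp (-2 * ‖w‖ ^ 2) =
        Real.exp (‖z‖ ^ 2 / 2) * Real.exp (-‖w - z‖ ^ 2 / 2) *
          Real.exp ((3 : ℕ) * (-‖w‖ ^ 2 / 2)) := by
        rw [← Real.exp_add, ← Real.exp_add, ← Real.exp_add]
        congr 1; push_cast; ring
      linear_combination ‖f w‖ ^ 3 * this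
    rw [e1]
    have htri : ‖z‖ ≤ ‖w‖ + ‖w - z‖ := by
      have := norm_sub_le w (w - z); simpa using this
    have e2 : Real.exp (-‖w - z‖ ^ 2 / 2) * Real.exp (-κ * ‖w‖) ≤
        Real.exp (κ ^ 2) * Real.exp (-κ * ‖z‖) * Real.exp (-(1 / 4) * ‖w - z‖ ^ 2) := by
      rw [← Real.exp_add, ← Real.exp_add, ← Real.exp_add]
      apply Real.exp_le_exp.2
      nlinarith [sq_nonneg (κ - ‖w - z‖ / 2), mul_le_mul_of_nonneg_left htri hκ]
    have e3 : Real.exp (-‖w - z‖ ^ 2 / 2) ≤ Real.exp (-(1 / 4) * ‖w - z‖ ^ 2) := by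
      apply Real.exp_le_exp.2
      nlinarith [sq_nonneg ‖w - z‖]
    calc _ ≤ Real.exp (‖z‖ ^ 2 / 2) * Real.exp (-‖w - z‖ ^ 2 / 2) *
          (S * Real.exp (-κ * ‖w‖) + T) := by gcongr; exact h w
      _ = Real.exp (‖z‖ ^ 2 / 2) * (S * (Real.exp (-‖w - z‖ ^ 2 / 2) * Real.exp (-κ * ‖w‖)) +
          T * Real.exp (-‖w - z‖ ^ 2 / 2)) := by ring
      _ ≤ Real.exp (‖z‖ ^ 2 / 2) * (S * (Real.exp (κ ^ 2) * Real.exp (-κ * ‖z‖) *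
          Real.exp (-(1 / 4) * ‖w - z‖ ^ 2)) + T * Real.exp (-(1 / 4) * ‖w - z‖ ^ 2)) :=
          mul_le_mul_of_nonneg_left (add_le_add (mul_le_mul_of_nonneg_left e2 hS)
            (mul_le_mul_of_nonneg_left e3 hT)) (by positivity)
      _ = _ := by rw [hD]; ring
  have hintg : Integrable (fun w : ℂ => (Real.exp (‖z‖ ^ 2 / 2) * D) *
      Real.exp (-(1 / 4) * ‖w - z‖ ^ 2)) :=
    ((gauss_integrable (b := 1 / 4) (by norm_num)).comp_sub_right z).const_mul _
  have hle := norm_integral_le_of_norm_le hintg (ae_of_all _ hpt)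
  rw [integral_const_mul, integral_sub_right_eq_self
    (fun w : ℂ => Real.exp (-(1 / 4) * ‖w‖ ^ 2)) z, gauss_integral (by norm_num)] at hle
  rw [heq z, norm_mul, norm_inv, Complex.norm_real, Real.norm_of_nonneg Real.pi_pos.le]
  have hpi := Real.pi_pos
  calc _ ≤ Real.pi⁻¹ * (Real.exp (‖z‖ ^ 2 / 2) * D * (Real.pi / (1 / 4))) := by gcongr
    _ = _ := by rw [hD]; field_simp

theorem linear_solve {f : ℂ → ℂ} (hf : Differentiable ℂ f) {M lam mu : ℝ} (hM : 0 ≤ M)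
    (hlm : lam ≠ 0 ∨ mu ≠ 0) (hfM : ∀ z, ‖f z‖ ≤ M * Real.exp (‖z‖ ^ 2 / 2)) :
    ∃ K : ℝ, 1 ≤ K ∧ ∀ κ S T : ℝ, 0 ≤ κ → 0 ≤ S → 0 ≤ T →
      (∀ z, ‖(lam : ℂ) * f z + mu * (z * deriv f z)‖ ≤
        (S * Real.exp (-κ * ‖z‖) + T) * Real.exp (‖z‖ ^ 2 / 2)) →
      ∀ z, ‖f z‖ ≤ ((K * S + K * Real.exp (K * (κ ^ 2 + 1))) * Real.exp (-κ * ‖z‖) + K * T) *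
        Real.exp (‖z‖ ^ 2 / 2) := by
  by_cases hmu : mu = 0
  · have hlam : lam ≠ 0 := by tauto
    have hl : 0 < |lam| := abs_pos.2 hlam
    have hl' : 0 < 1 / |lam| := by positivity
    refine ⟨1 + 1 / |lam|, by linarith, fun κ S T hκ hS hT h z => ?_⟩
    have h1 := h z
    simp only [hmu, Complex.ofReal_zero, zero_mul, add_zero, norm_mul, Complex.norm_real,
      Real.norm_eq_abs] at h1
    have h2 : ‖f z‖ ≤ 1 / |lam| * ((S * Real.exp (-κ * ‖z‖) + T) * Real.exp (‖z‖ ^ 2 / 2)) := by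
      rw [one_div, ← div_eq_inv_mul, le_div_iff₀ hl]; linarith
    refine h2.trans ?_
    rw [← mul_assoc]
    gcongr
    set K := 1 + 1 / |lam| with hK
    have hK1 : 1 / |lam| ≤ K := by rw [hK]; linarith
    have hK0 : 0 < K := by rw [hK]; positivity
    have e0 : 0 ≤ K * Real.exp (K * (κ ^ 2 + 1)) * Real.exp (-κ * ‖z‖) := by positivity
    have e1 := mul_le_mul_of_nonneg_right hK1 (show 0 ≤ S * Real.exp (-κ * ‖z‖) by positivity)
    have e2 := mul_le_mul_of_nonneg_right hK1 hT
    nlinarith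
  · have hm : 0 < |mu| := abs_pos.2 hmu
    set ν := lam / mu with hν
    set K := 1 / |mu| + M + |ν| + 2 with hK
    have hm' : 0 < 1 / |mu| := by positivity
    have hK1 : 1 / |mu| ≤ K := by rw [hK]; linarith [abs_nonneg ν]
    have hKM : M ≤ K := by rw [hK]; linarith [abs_nonneg ν]
    have hKν : |ν| + 2 ≤ K := by rw [hK]; linarith [abs_nonneg ν]
    have hK0 : 0 < K := by linarith [abs_nonneg ν]
    refine ⟨K, by linarith [abs_nonneg ν], fun κ S T hκ hS hT h z => ?_⟩
    set r0 := κ + |ν| + 1 with hr0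
    have hr0p : 0 < r0 := by positivity
    set D1 := S / |mu| + M * Real.exp (κ * r0) with hD1
    set D2 := T / |mu| with hD2
    have hD10 : 0 ≤ D1 := by positivity
    have hD20 : 0 ≤ D2 := by positivity
    suffices hmain : ‖f z‖ ≤ (D1 * Real.exp (-κ * ‖z‖) + D2) * Real.exp (‖z‖ ^ 2 / 2) by
      refine hmain.trans ?_
      have e1 : D1 ≤ K * S + K * Real.exp (K * (κ ^ 2 + 1)) := by
        rw [hD1]
        apply add_le_add
        · rw [div_eq_inv_mul, ← one_div]; gcongr
        · have : κ * r0 ≤ K * (κ ^ 2 + 1) := by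
            have h1 : (|ν| + 2) * (κ ^ 2 + 1) ≤ K * (κ ^ 2 + 1) := by gcongr
            refine le_trans ?_ h1
            rw [hr0]
            have h2 : κ ≤ κ ^ 2 + 1 := by nlinarith [sq_nonneg (κ - 1 / 2)]
            have h3 := mul_le_mul_of_nonneg_left h2 (abs_nonneg ν)
            nlinarith
          gcongr
      have e2 : D2 ≤ K * T := by
        rw [hD2, div_eq_inv_mul, ← one_div]; gcongr
      gcongr
    rcases le_or_gt ‖z‖ r0 with hz | hz
    · refine (hfM z).trans ?_
      gcongr
      have e1 : 1 ≤ Real.exp (κ * r0) * Real.exp (-κ * ‖z‖) := by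
        rw [← Real.exp_add]
        apply Real.one_le_exp
        nlinarith
      have e2 := mul_le_mul_of_nonneg_left e1 hM
      have e3 : 0 ≤ S / |mu| * Real.exp (-κ * ‖z‖) := by positivity
      rw [hD1]
      nlinarith
    · have hz0 : 0 < ‖z‖ := by linarith
      set ω : ℂ := z / ‖z‖ with hω
      have hzω : ((‖z‖ : ℝ) : ℂ) * ω = z := by
        rw [hω]; field_simp
        exact mul_div_cancel_left₀ z (by exact_mod_cast hz0.ne')
      have hωn : ‖ω‖ = 1 := by
        rw [hω, norm_div, Complex.norm_real, norm_norm, div_self hz0.ne']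
      have hns : ∀ s : ℝ, 0 < s → ‖(s : ℂ) * ω‖ = s := by
        intro s hs; rw [norm_mul, hωn, mul_one, Complex.norm_real, Real.norm_of_nonneg hs.le]
      let Φ : ℝ → ℂ := fun s => ((s ^ ν : ℝ) : ℂ) * f ((s : ℂ) * ω)
      let Φ' : ℝ → ℂ := fun s => ((s ^ (ν - 1) / mu : ℝ) : ℂ) *
        ((lam : ℂ) * f (s * ω) + mu * ((s * ω) * deriv f (s * ω)))
      let Bd : ℝ → ℝ := fun s => s ^ ν * ((D1 * Real.exp (-κ * s) + D2) * Real.exp (s ^ 2 / 2))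
      let Bd' : ℝ → ℝ := fun s => s ^ (ν - 1) * ((D1 * (ν + s ^ 2 - κ * s) * Real.exp (-κ * s) +
        D2 * (ν + s ^ 2)) * Real.exp (s ^ 2 / 2))
      have hpow : ∀ s : ℝ, 0 < s → s ^ ν = s ^ (ν - 1) * s := by
        intro s hs
        rw [Real.rpow_sub_one hs.ne']; field_simp
      have hΦd : ∀ s : ℝ, 0 < s → HasDerivAt Φ (Φ' s) s := by
        intro s hs
        have h1 : HasDerivAt (fun s : ℝ => ((s ^ ν : ℝ) : ℂ)) ((ν * s ^ (ν - 1) : ℝ) : ℂ) s :=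
          (Real.hasDerivAt_rpow_const (Or.inl hs.ne')).ofReal_comp
        have h2 : HasDerivAt (fun s : ℝ => f ((s : ℂ) * ω)) (deriv f (s * ω) * ω) s := by
          have h3 : HasDerivAt (fun s : ℂ => f (s * ω)) (deriv f (s * ω) * ω) (s : ℂ) := by
            have h4 : HasDerivAt (fun s : ℂ => s * ω) ω (s : ℂ) := by
              simpa using (hasDerivAt_id (s : ℂ)).mul_const ω
            exact (hf _).hasDerivAt.comp (s : ℂ) h4
          exact h3.comp_ofReal
        refine (h1.mul h2).congr_deriv ?_
        have : (mu : ℂ) ≠ 0 := by exact_mod_cast hmu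
        have hln : (lam : ℂ) = ν * mu := by rw [hν]; push_cast; field_simp
        simp only [Φ']
        rw [hpow s hs, hln]
        generalize s ^ (ν - 1) = P
        push_cast
        field_simp
      have hBd : ∀ s : ℝ, 0 < s → HasDerivAt Bd (Bd' s) s := by
        intro s hs
        have h1 : HasDerivAt (fun s : ℝ => s ^ ν) (ν * s ^ (ν - 1)) s :=
          Real.hasDerivAt_rpow_const (Or.inl hs.ne')
        have h2 : HasDerivAt (fun s : ℝ => Real.exp (-κ * s)) (Real.exp (-κ * s) * -κ) s := by
          have := ((hasDerivAt_id s).const_mul (-κ)).exp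
          simpa using this
        have h3 : HasDerivAt (fun s : ℝ => Real.exp (s ^ 2 / 2)) (Real.exp (s ^ 2 / 2) * s) s := by
          have := ((hasDerivAt_pow 2 s).div_const 2).exp
          refine this.congr_deriv ?_
          simp
        refine (h1.mul (((h2.const_mul D1).add_const D2).mul h3)).congr_deriv ?_
        simp only [Bd', hpow s hs, Pi.mul_apply]
        ring
      have key := image_norm_le_of_norm_deriv_right_le_deriv_boundary' (f := Φ) (f' := Φ')
        (a := r0) (b := ‖z‖) (B := Bd) (B' := Bd')
        (fun s hs => (hΦd s (by linarith [hs.1])).continuousAt.continuousWithinAt)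
        (fun s hs => (hΦd s (by linarith [hs.1])).hasDerivWithinAt) ?_
        (fun s hs => (hBd s (by linarith [hs.1])).continuousAt.continuousWithinAt)
        (fun s hs => (hBd s (by linarith [hs.1])).hasDerivWithinAt) ?_
        (Set.right_mem_Icc.2 hz.le)
      · simp only [Φ, Bd, hzω] at key
        rw [norm_mul, Complex.norm_real, Real.norm_of_nonneg (by positivity)] at key
        exact le_of_mul_le_mul_left key (by positivity)
      · simp only [Φ, Bd]
        rw [norm_mul, Complex.norm_real, Real.norm_of_nonneg (by positivity)]
        gcongr
        have h1 := hfM (r0 * ω)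
        rw [hns r0 hr0p] at h1
        refine h1.trans ?_
        gcongr
        have e1 : Real.exp (κ * r0) * Real.exp (-κ * r0) = 1 := by
          rw [← Real.exp_add]; simp
        have e3 : 0 ≤ S / |mu| * Real.exp (-κ * r0) := by positivity
        rw [hD1]
        have e4 : M * Real.exp (κ * r0) * Real.exp (-κ * r0) = M := by rw [mul_assoc, e1, mul_one]
        nlinarith
      · intro s hs
        have hs1 : r0 ≤ s := hs.1
        have hs0 : 0 < s := by linarith
        simp only [Φ', Bd']
        rw [norm_mul, Complex.norm_real, Real.norm_eq_abs, abs_div,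
          abs_of_nonneg (Real.rpow_nonneg hs0.le _), div_mul_eq_mul_div, mul_div_assoc]
        gcongr
        have h1 := h (s * ω)
        rw [hns s hs0] at h1
        have hfac : 1 ≤ ν + s ^ 2 - κ * s := by
          have h3 : -|ν| ≤ ν := neg_abs_le ν
          have h4 : |ν| + 1 ≤ s - κ := by rw [hr0] at hs1; linarith
          have h5 : 1 ≤ s := by rw [hr0] at hs1; linarith [abs_nonneg ν]
          nlinarith [abs_nonneg ν]
        have hfac2 : 1 ≤ ν + s ^ 2 := by nlinarith
        rw [div_le_iff₀ hm]
        refine h1.trans ?_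
        rw [mul_right_comm]
        gcongr
        have e1 : S / |mu| ≤ D1 := by
          rw [hD1]; have : 0 ≤ M * Real.exp (κ * r0) := by positivity
          linarith
        have e2 : D1 ≤ D1 * (ν + s ^ 2 - κ * s) := le_mul_of_one_le_right hD10 hfac
        have e3 : D2 ≤ D2 * (ν + s ^ 2) := le_mul_of_one_le_right hD20 hfac2
        have e4 : S ≤ D1 * (ν + s ^ 2 - κ * s) * |mu| := by
          have := mul_le_mul_of_nonneg_right (e1.trans e2) hm.le
          rwa [div_mul_cancel₀ _ hm.ne'] at this
        have e5 : T ≤ D2 * (ν + s ^ 2) * |mu| := by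
          have := mul_le_mul_of_nonneg_right e3 hm.le
          rwa [hD2, div_mul_cancel₀ _ hm.ne', ← hD2] at this
        have e6 := mul_le_mul_of_nonneg_right e4 (Real.exp_pos (-κ * s)).le
        nlinarith

theorem gauss_decay {f : ℂ → ℂ} (hf : Differentiable ℂ f) {M lam mu : ℝ} (hM : 0 ≤ M)
    (hlm : lam ≠ 0 ∨ mu ≠ 0) (hfM : ∀ z, ‖f z‖ ≤ M * Real.exp (‖z‖ ^ 2 / 2))
    (heq : ∀ z, (lam : ℂ) * f z + mu * (z * deriv f z) =
      (Real.pi : ℂ)⁻¹ * ∫ w : ℂ, Complex.exp ((starRingEnd ℂ) w * z) *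
      (((starRingEnd ℂ) (f w)) * f w ^ 2 * (Real.exp (-2 * ‖w‖ ^ 2) : ℂ)))
    (hdec : ∀ ε : ℝ, 0 < ε → ∃ R0 : ℝ, ∀ z, R0 ≤ ‖z‖ → ‖f z‖ * Real.exp (-‖z‖ ^ 2 / 2) ≤ ε) :
    ∃ C α : ℝ, α < 1 / 2 ∧ ∀ z, ‖f z‖ ≤ C * Real.exp (α * ‖z‖ ^ 2) := by
  obtain ⟨K, hK, hsolve⟩ := linear_solve hf hM hlm hfM
  have hK0 : 0 < K := by linarith
  set U : ℂ → ℝ := fun z => ‖f z‖ * Real.exp (-‖z‖ ^ 2 / 2) with hU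
  have hU0 : ∀ z, 0 ≤ U z := fun z => by positivity
  have hee : ∀ z : ℂ, Real.exp (‖z‖ ^ 2 / 2) * Real.exp (-‖z‖ ^ 2 / 2) = 1 := by
    intro z; rw [← Real.exp_add]; rw [show ‖z‖ ^ 2 / 2 + -‖z‖ ^ 2 / 2 = 0 by ring]; simp
  have hconv : ∀ z X, ‖f z‖ ≤ X * Real.exp (‖z‖ ^ 2 / 2) → U z ≤ X := by
    intro z X h
    have := mul_le_mul_of_nonneg_right h (Real.exp_pos (-‖z‖ ^ 2 / 2)).le
    rwa [mul_assoc, hee, mul_one] at this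
  have hUM : ∀ z, U z ≤ M := fun z => hconv z M (hfM z)
  have boot : ∀ κ S T : ℝ, 0 ≤ κ → 0 ≤ S → 0 ≤ T →
      (∀ w, U w ^ 3 ≤ S * Real.exp (-κ * ‖w‖) + T) →
      ∀ z, U z ≤ (K * (4 * Real.exp (κ ^ 2) * S) + K * Real.exp (K * (κ ^ 2 + 1))) *
        Real.exp (-κ * ‖z‖) + K * (4 * T) := by
    intro κ S T hκ hS hT h z
    apply hconv
    exact hsolve κ (4 * Real.exp (κ ^ 2) * S) (4 * T) hκ (by positivity) (by positivity)
      (fun z => kernel_bound heq hκ hS hT h z) z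
  -- first exponential decay
  obtain ⟨A1, hA1, hexp⟩ : ∃ A1 : ℝ, 0 ≤ A1 ∧ ∀ z, U z ≤ A1 * Real.exp (-‖z‖) := by
    set ε : ℝ := 1 / (8 * K * Real.exp 1) with hε
    have he1 : 1 ≤ Real.exp 1 := Real.one_le_exp (by norm_num)
    have hε0 : 0 < ε := by positivity
    have hε1 : ε ≤ 1 := by
      rw [hε, div_le_one (by positivity)]; nlinarith
    have hεK : 8 * K * Real.exp 1 * ε = 1 := by rw [hε]; field_simp
    have hε2 : ε ^ 2 ≤ ε := by nlinarith
    obtain ⟨R0, hR0⟩ := hdec ε hε0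
    set Q := M ^ 3 * Real.exp R0 with hQ
    have hQ0 : 0 ≤ Q := by positivity
    set A := 2 * (K * (4 * Real.exp 1 * Q) + K * Real.exp (K * 2)) with hA
    have hA0 : 0 ≤ A := by positivity
    refine ⟨A, hA0, ?_⟩
    have hind : ∀ j : ℕ, ∀ z, U z ≤ A * Real.exp (-‖z‖) + M * (1 / 2) ^ j := by
      intro j
      induction j with
      | zero =>
        intro z
        have := hUM z
        have : 0 ≤ A * Real.exp (-‖z‖) := by positivity
        simp; linarith [hUM z]
      | succ j ih =>
        have hcube : ∀ w, U w ^ 3 ≤ (ε * A + Q) * Real.exp (-1 * ‖w‖) + ε * (M * (1 / 2) ^ j) := by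
          intro w
          have hUw := hU0 w
          rcases le_or_gt R0 ‖w‖ with hw | hw
          · have h1 : U w ≤ ε := hR0 w hw
            have h2 : U w ^ 2 ≤ ε := (pow_le_pow_left₀ hUw h1 2).trans hε2
            calc U w ^ 3 = U w ^ 2 * U w := by ring
              _ ≤ ε * (A * Real.exp (-‖w‖) + M * (1 / 2) ^ j) := by
                  apply mul_le_mul h2 (ih w) hUw hε0.le
              _ = ε * A * Real.exp (-‖w‖) + ε * (M * (1 / 2) ^ j) := by ring
              _ ≤ _ := by
                  rw [neg_one_mul]
                  gcongr
                  linarith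
          · have h1 : U w ^ 3 ≤ M ^ 3 := pow_le_pow_left₀ hUw (hUM w) 3
            have h2 : M ^ 3 ≤ Q * Real.exp (-‖w‖) := by
              rw [hQ, mul_assoc, ← Real.exp_add]
              exact le_mul_of_one_le_right (by positivity) (Real.one_le_exp (by linarith))
            have h3 : 0 ≤ ε * A * Real.exp (-‖w‖) := by positivity
            have h4 : 0 ≤ ε * (M * (1 / 2) ^ j) := by positivity
            rw [neg_one_mul]
            nlinarith
        intro z
        have hb := boot 1 (ε * A + Q) (ε * (M * (1 / 2) ^ j)) (by norm_num) (by positivity)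
          (by positivity) hcube z
        refine hb.trans ?_
        rw [neg_one_mul]
        apply add_le_add
        · apply mul_le_mul_of_nonneg_right _ (Real.exp_pos _).le
          have e1 : K * (4 * Real.exp (1 ^ 2) * (ε * A + Q)) =
              (8 * K * Real.exp 1 * ε) * (A / 2) + K * (4 * Real.exp 1 * Q) := by
            rw [one_pow]; ring
          rw [e1, hεK]
          have e2 : K * Real.exp (K * (1 ^ 2 + 1)) = K * Real.exp (K * 2) := by norm_num
          rw [e2]
          linarith
        · have e3 : 8 * K * ε ≤ 1 := by
            calc 8 * K * ε ≤ 8 * K * ε * Real.exp 1 := le_mul_of_one_le_right (by positivity) he1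
              _ = 1 := by linarith
          have e4 : 0 ≤ M * (1 / 2) ^ j := by positivity
          rw [pow_succ]
          nlinarith
    intro z
    have hl : Filter.Tendsto (fun j : ℕ => A * Real.exp (-‖z‖) + M * (1 / 2 : ℝ) ^ j) Filter.atTop
        (nhds (A * Real.exp (-‖z‖) + M * 0)) :=
      tendsto_const_nhds.add ((tendsto_pow_atTop_nhds_zero_of_lt_one (by norm_num)
        (by norm_num)).const_mul M)
    have := ge_of_tendsto' hl (fun j => hind j z)
    simpa using this
  -- cubic iteration
  set A := 11 * K + A1 + 10 with hA
  have hA0 : 0 < A := by positivity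
  have hcub : ∀ j : ℕ, ∀ z, U z ≤ Real.exp (A * 9 ^ j) * Real.exp (-(3 ^ j) * ‖z‖) := by
    intro j
    induction j with
    | zero =>
      intro z
      refine (hexp z).trans ?_
      simp only [pow_zero, mul_one, neg_one_mul]
      gcongr
      linarith [Real.add_one_le_exp A]
    | succ j ih =>
      intro z
      have hx : (1 : ℝ) ≤ 9 ^ j := one_le_pow₀ (by norm_num)
      have hcube : ∀ w, U w ^ 3 ≤ Real.exp (3 * A * 9 ^ j) * Real.exp (-(3 ^ (j + 1)) * ‖w‖) + 0 := by
        intro w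
        have := pow_le_pow_left₀ (hU0 w) (ih w) 3
        refine this.trans (le_of_eq ?_)
        rw [mul_pow, ← Real.exp_nat_mul, ← Real.exp_nat_mul, add_zero]
        congr 2
        · push_cast; ring
        · push_cast; ring
      have hb := boot (3 ^ (j + 1)) (Real.exp (3 * A * 9 ^ j)) 0 (by positivity) (by positivity)
        le_rfl hcube z
      refine hb.trans ?_
      have hk2 : ((3 : ℝ) ^ (j + 1)) ^ 2 = 9 * 9 ^ j := by
        rw [← pow_mul, mul_comm, pow_mul]; norm_num; ring
      rw [mul_zero, mul_zero, add_zero, hk2]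
      apply mul_le_mul_of_nonneg_right _ (Real.exp_pos _).le
      set x : ℝ := 9 ^ j with hxd
      have h2 : (2 : ℝ) ≤ Real.exp 1 := by linarith [Real.add_one_le_exp (1 : ℝ)]
      have e1 : 2 * (K * (4 * Real.exp (9 * x) * Real.exp (3 * A * x))) ≤
          Real.exp (A * 9 ^ (j + 1)) := by
        have h4 : 4 * K ≤ Real.exp (4 * K) := by linarith [Real.add_one_le_exp (4 * K)]
        calc 2 * (K * (4 * Real.exp (9 * x) * Real.exp (3 * A * x)))
            = 2 * (4 * K) * Real.exp (9 * x) * Real.exp (3 * A * x) := by ring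
          _ ≤ Real.exp 1 * Real.exp (4 * K) * Real.exp (9 * x) * Real.exp (3 * A * x) := by
              gcongr
          _ = Real.exp (1 + 4 * K + 9 * x + 3 * A * x) := by
              rw [Real.exp_add, Real.exp_add, Real.exp_add]
          _ ≤ _ := by
              apply Real.exp_le_exp.2
              rw [pow_succ, ← hxd]
              have : 10 + 4 * K ≤ 6 * A := by rw [hA]; linarith
              nlinarith
      have e2 : 2 * (K * Real.exp (K * (9 * x + 1))) ≤ Real.exp (A * 9 ^ (j + 1)) := by
        have h4 : K ≤ Real.exp K := by linarith [Real.add_one_le_exp K]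
        calc 2 * (K * Real.exp (K * (9 * x + 1)))
            ≤ Real.exp 1 * (Real.exp K * Real.exp (K * (9 * x + 1))) := by gcongr
          _ = Real.exp (1 + (K + K * (9 * x + 1))) := by rw [Real.exp_add, Real.exp_add K]
          _ ≤ _ := by
              apply Real.exp_le_exp.2
              rw [pow_succ, ← hxd]
              have : 11 * K + 1 ≤ 9 * A := by rw [hA]; linarith
              nlinarith
      linarith
  -- conclusion
  set c := 1 / (12 * A) with hc
  have hc0 : 0 < c := by positivity
  refine ⟨M * Real.exp (c * (2 * A) ^ 2) + 1, 1 / 2 - c, by linarith, fun z => ?_⟩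
  have hfin : U z ≤ (M * Real.exp (c * (2 * A) ^ 2) + 1) * Real.exp (-c * ‖z‖ ^ 2) := by
    rcases le_or_gt (2 * A) ‖z‖ with hz | hz
    · obtain ⟨j, hj1, hj2⟩ := exists_nat_pow_near (x := ‖z‖ / (2 * A)) (y := 3)
        (by rw [le_div_iff₀ (by positivity)]; linarith) (by norm_num)
      refine (hcub j z).trans ?_
      have h1 : Real.exp (A * 9 ^ j) * Real.exp (-(3 ^ j) * ‖z‖) ≤ Real.exp (-c * ‖z‖ ^ 2) := by
        rw [← Real.exp_add]
        apply Real.exp_le_exp.2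
        have h9 : (9 : ℝ) ^ j = (3 ^ j) ^ 2 := by rw [← pow_mul, mul_comm, pow_mul]; norm_num
        rw [h9]
        rw [pow_succ] at hj2
        set y : ℝ := 3 ^ j with hy
        have hy0 : 0 < y := by positivity
        rw [le_div_iff₀ (by positivity)] at hj1
        rw [div_lt_iff₀ (by positivity)] at hj2
        have h2 : A * y ^ 2 ≤ y * ‖z‖ / 2 := by nlinarith
        have h3 : c * ‖z‖ ^ 2 ≤ y * ‖z‖ / 2 := by
          rw [hc, one_div, ← div_eq_inv_mul, div_le_iff₀ (by positivity)]
          nlinarith [norm_nonneg z]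
        linarith
      refine h1.trans (le_mul_of_one_le_left (by positivity) ?_)
      have : 0 ≤ M * Real.exp (c * (2 * A) ^ 2) := by positivity
      linarith
    · refine (hUM z).trans ?_
      have h1 : M ≤ M * Real.exp (c * (2 * A) ^ 2) * Real.exp (-c * ‖z‖ ^ 2) := by
        rw [mul_assoc, ← Real.exp_add]
        refine le_mul_of_one_le_right hM (Real.one_le_exp ?_)
        have : ‖z‖ ^ 2 ≤ (2 * A) ^ 2 := pow_le_pow_left₀ (norm_nonneg z) hz.le 2
        nlinarith
      have : 0 ≤ Real.exp (-c * ‖z‖ ^ 2) := by positivity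
      linarith
  have h1 := mul_le_mul_of_nonneg_right hfin (Real.exp_pos (‖z‖ ^ 2 / 2)).le
  have h2 : U z * Real.exp (‖z‖ ^ 2 / 2) = ‖f z‖ := by
    rw [hU]; simp only; rw [mul_assoc, mul_comm (Real.exp _), hee, mul_one]
  rw [h2, mul_assoc, ← Real.exp_add] at h1
  refine h1.trans (le_of_eq ?_)
  congr 2; ring

theorem exp_lin_integrable {b : ℝ} (hb : 0 < b) :
    Integrable (fun w : ℂ => Real.exp (-b * ‖w‖)) := by
  apply Integrable.of_integral_ne_zero
  have h := Complex.integral_exp_neg_mul_rpow (p := 1) le_rfl hb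
  simp only [Real.rpow_one] at h
  rw [h]
  have := Real.Gamma_pos_of_pos (show (0 : ℝ) < 2 / 1 + 1 by norm_num)
  positivity

theorem conv_right {h E : ℂ → ℝ} (hh : Integrable h) (hE : Integrable E) :
    Integrable (fun p : ℂ × ℂ => h p.2 * E (p.1 - p.2)) (volume.prod volume) ∧
      ∫ p : ℂ × ℂ, h p.2 * E (p.1 - p.2) ∂(volume.prod volume) = (∫ w, h w) * ∫ w, E w := by
  have hi : Integrable (fun p : ℂ × ℂ => h p.2 * E (p.1 - p.2)) (volume.prod volume) :=
    Integrable.convolution_integrand (ContinuousLinearMap.mul ℝ ℝ) hh hE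
  refine ⟨hi, ?_⟩
  rw [integral_prod_symm _ hi]
  simp only [integral_const_mul]
  rw [← integral_mul_const]
  congr 1
  ext w
  rw [integral_sub_right_eq_self E w]

theorem conv_left {h E : ℂ → ℝ} (hh : Integrable h) (hE : Integrable E) (hev : ∀ w, E (-w) = E w) :
    Integrable (fun p : ℂ × ℂ => h p.1 * E (p.1 - p.2)) (volume.prod volume) ∧
      ∫ p : ℂ × ℂ, h p.1 * E (p.1 - p.2) ∂(volume.prod volume) = (∫ w, h w) * ∫ w, E w := by
  obtain ⟨h1, h2⟩ := conv_right hh hE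
  have e : (fun p : ℂ × ℂ => h p.1 * E (p.1 - p.2)) =
      (fun p : ℂ × ℂ => h p.2 * E (p.1 - p.2)) ∘ Prod.swap := by
    ext p
    simp only [Function.comp, Prod.fst_swap, Prod.snd_swap]
    rw [← hev, neg_sub]
  constructor
  · rw [e]; exact h1.swap
  · rw [← h2, e]; exact integral_prod_swap (fun p : ℂ × ℂ => h p.2 * E (p.1 - p.2))

theorem zero_case {f : ℂ → ℂ} (hf : Differentiable ℂ f) {M : ℝ} (hM : 0 ≤ M)
    (hfM : ∀ z, ‖f z‖ ≤ M * Real.exp ((1 / 2) * ‖z‖ ^ 2))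
    (heq : ∀ z, ∫ w : ℂ, Complex.exp ((starRingEnd ℂ) w * z) *
      (((starRingEnd ℂ) (f w)) * f w ^ 2 * (Real.exp (-2 * ‖w‖ ^ 2) : ℂ)) = 0) (z : ℂ) :
    f z = 0 := by
  have hfc := hf.continuous
  set U : ℂ → ℝ := fun z => ‖f z‖ * Real.exp (-‖z‖ ^ 2 / 2) with hU
  have hUc : Continuous U := by fun_prop
  have hU0 : ∀ z, 0 ≤ U z := fun z => by positivity
  have hUM : ∀ z, U z ≤ M := by
    intro z
    have h := mul_le_mul_of_nonneg_right (hfM z) (Real.exp_pos (-‖z‖ ^ 2 / 2)).le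
    rwa [mul_assoc, ← Real.exp_add, show (1 / 2) * ‖z‖ ^ 2 + -‖z‖ ^ 2 / 2 = 0 by ring,
      Real.exp_zero, mul_one] at h
  set ε : ℝ := Real.exp (-4) / 16 with hε
  have hε0 : 0 < ε := by positivity
  have hε1 : ε ≤ 1 := by
    have : Real.exp (-4) ≤ 1 := Real.exp_le_one_iff.2 (by norm_num)
    rw [hε]; linarith
  set χ : ℂ → ℝ := fun z => Real.exp (-ε * ‖z‖) with hχ
  have hχc : Continuous χ := by fun_prop
  have hχ0 : ∀ z, 0 < χ z := fun z => Real.exp_pos _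
  have hχi : Integrable χ := exp_lin_integrable hε0
  set E : ℂ → ℝ := fun z => Real.exp (-(1 / 4) * ‖z‖ ^ 2) with hE
  have hEi : Integrable E := gauss_integrable (by norm_num)
  have hEev : ∀ w, E (-w) = E w := by intro w; simp only [hE, norm_neg]
  have hEI : ∫ w, E w = 4 * Real.pi := by
    rw [hE, gauss_integral (by norm_num)]; ring
  set X : ℂ → ℝ := fun z => χ z * U z ^ 4 with hX
  have hX0 : ∀ z, 0 ≤ X z := fun z => mul_nonneg (hχ0 z).le (pow_nonneg (hU0 z) 4)
  have hXi : Integrable X := by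
    refine (hχi.mul_const (M ^ 4)).mono' (by fun_prop) (ae_of_all _ fun w => ?_)
    rw [Real.norm_of_nonneg (hX0 w)]
    exact mul_le_mul_of_nonneg_left (pow_le_pow_left₀ (hU0 w) (hUM w) 4) (hχ0 w).le
  set J := ∫ w, X w with hJ
  have hJ0 : 0 ≤ J := integral_nonneg hX0
  set F : ℂ × ℂ → ℂ := fun p => ((starRingEnd ℂ) (f p.1) *
    Complex.exp ((starRingEnd ℂ) p.2 * p.1) * (Real.exp (-1 * ‖p.1‖ ^ 2) : ℂ)) *
    ((starRingEnd ℂ) (f p.2) * f p.2 ^ 2 * (Real.exp (-2 * ‖p.2‖ ^ 2) : ℂ)) with hF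
  have hFc : Continuous F := by
    have := Complex.continuous_conj
    fun_prop
  have hFn : ∀ p, ‖F p‖ = U p.1 * U p.2 ^ 3 * Real.exp (-‖p.1 - p.2‖ ^ 2 / 2) := by
    rintro ⟨z, w⟩
    have hexp : ((starRingEnd ℂ) w * z).re = ‖z‖ ^ 2 / 2 + ‖w‖ ^ 2 / 2 - ‖z - w‖ ^ 2 / 2 := by
      rw [Complex.sq_norm, Complex.sq_norm, Complex.sq_norm, Complex.normSq_apply,
        Complex.normSq_apply, Complex.normSq_apply]
      simp
      ring
    simp only [hF, hU]
    rw [norm_mul, norm_mul, norm_mul, norm_mul, norm_mul, norm_pow, RCLike.norm_conj,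
      RCLike.norm_conj, Complex.norm_exp, hexp, Complex.norm_real, Complex.norm_real,
      Real.norm_of_nonneg (Real.exp_pos _).le, Real.norm_of_nonneg (Real.exp_pos _).le, mul_pow,
      ← Real.exp_nat_mul]
    have : Real.exp (‖z‖ ^ 2 / 2 + ‖w‖ ^ 2 / 2 - ‖z - w‖ ^ 2 / 2) * Real.exp (-1 * ‖z‖ ^ 2) *
        Real.exp (-2 * ‖w‖ ^ 2) = Real.exp (-‖z‖ ^ 2 / 2) * Real.exp ((3 : ℕ) * (-‖w‖ ^ 2 / 2)) *
          Real.exp (-‖z - w‖ ^ 2 / 2) := by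
      rw [← Real.exp_add, ← Real.exp_add, ← Real.exp_add, ← Real.exp_add]
      congr 1; push_cast; ring
    linear_combination ‖f z‖ * ‖f w‖ ^ 3 * this
  have hgE : ∀ y : ℂ, Real.exp (-‖y‖ ^ 2 / 2) ≤ E y := by
    intro y
    apply Real.exp_le_exp.2
    nlinarith [sq_nonneg ‖y‖]
  have hFM : ∀ p, ‖F p‖ ≤ M ^ 4 * E (p.1 - p.2) := by
    intro p
    rw [hFn]
    have h1 : U p.1 * U p.2 ^ 3 ≤ M * M ^ 3 :=
      mul_le_mul (hUM _) (pow_le_pow_left₀ (hU0 _) (hUM _) 3) (pow_nonneg (hU0 _) 3) hM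
    calc _ ≤ (M * M ^ 3) * E (p.1 - p.2) :=
          mul_le_mul h1 (hgE _) (Real.exp_pos _).le (by positivity)
      _ = _ := by ring
  have hA1 : Integrable (fun p : ℂ × ℂ => (χ p.1 : ℂ) * F p) (volume.prod volume) := by
    refine ((conv_left hχi hEi hEev).1.const_mul (M ^ 4)).mono'
      (Continuous.aestronglyMeasurable (by fun_prop)) (ae_of_all _ fun p => ?_)
    rw [norm_mul, Complex.norm_real, Real.norm_of_nonneg (hχ0 _).le]
    have := mul_le_mul_of_nonneg_left (hFM p) (hχ0 p.1).le
    linarith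
  have hA2 : Integrable (fun p : ℂ × ℂ => (χ p.2 : ℂ) * F p) (volume.prod volume) := by
    refine ((conv_right hχi hEi).1.const_mul (M ^ 4)).mono'
      (Continuous.aestronglyMeasurable (by fun_prop)) (ae_of_all _ fun p => ?_)
    rw [norm_mul, Complex.norm_real, Real.norm_of_nonneg (hχ0 _).le]
    have := mul_le_mul_of_nonneg_left (hFM p) (hχ0 p.2).le
    linarith
  have hI1 : ∫ p : ℂ × ℂ, (χ p.1 : ℂ) * F p ∂(volume.prod volume) = 0 := by
    rw [integral_prod _ hA1]
    have : ∀ z : ℂ, ∫ w : ℂ, (χ (z, w).1 : ℂ) * F (z, w) = 0 := by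
      intro z
      have h1 : ∀ w : ℂ, (χ (z, w).1 : ℂ) * F (z, w) = ((χ z : ℂ) * ((starRingEnd ℂ) (f z) *
          (Real.exp (-1 * ‖z‖ ^ 2) : ℂ))) * (Complex.exp ((starRingEnd ℂ) w * z) *
          (((starRingEnd ℂ) (f w)) * f w ^ 2 * (Real.exp (-2 * ‖w‖ ^ 2) : ℂ))) := by
        intro w; simp only [hF]; ring
      rw [integral_congr_ae (ae_of_all _ h1), integral_const_mul, heq, mul_zero]
    simp only [this, integral_zero]
  have hI2 : ∫ p : ℂ × ℂ, (χ p.2 : ℂ) * F p ∂(volume.prod volume) = ((Real.pi * J : ℝ) : ℂ) := by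
    rw [integral_prod_symm _ hA2]
    have : ∀ w : ℂ, ∫ z : ℂ, (χ (z, w).2 : ℂ) * F (z, w) = ((Real.pi * X w : ℝ) : ℂ) := by
      intro w
      have h1 : ∀ z : ℂ, (χ (z, w).2 : ℂ) * F (z, w) = ((χ w : ℂ) * ((starRingEnd ℂ) (f w) *
          f w ^ 2 * (Real.exp (-2 * ‖w‖ ^ 2) : ℂ))) * (starRingEnd ℂ)
          (Complex.exp ((starRingEnd ℂ) z * w) * f z * (Real.exp (-1 * ‖z‖ ^ 2) : ℂ)) := by
        intro z
        simp only [hF, map_mul, ← Complex.exp_conj, Complex.conj_conj, Complex.conj_ofReal]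
        rw [mul_comm z]; ring
      rw [integral_congr_ae (ae_of_all _ h1), integral_const_mul, integral_conj,
        reproducing hf hfM w, map_mul, Complex.conj_ofReal]
      have h2 : (starRingEnd ℂ) (f w) * f w = ((‖f w‖ ^ 2 : ℝ) : ℂ) := by
        rw [mul_comm, Complex.mul_conj, Complex.normSq_eq_norm_sq]
      have h3 : X w = χ w * ((‖f w‖ ^ 2) ^ 2 * Real.exp (-2 * ‖w‖ ^ 2)) := by
        simp only [hX, hU]
        rw [mul_pow, ← Real.exp_nat_mul]
        rw [show ((4 : ℕ) : ℝ) * (-‖w‖ ^ 2 / 2) = -2 * ‖w‖ ^ 2 by push_cast; ring]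
        ring
      rw [h3]
      have h4 : ((Real.pi * (χ w * ((‖f w‖ ^ 2) ^ 2 * Real.exp (-2 * ‖w‖ ^ 2))) : ℝ) : ℂ) =
        (Real.pi : ℂ) * ((χ w : ℂ) * (((‖f w‖ ^ 2 : ℝ) : ℂ) ^ 2 *
          (Real.exp (-2 * ‖w‖ ^ 2) : ℂ))) := by push_cast; ring
      rw [h4, ← h2]
      ring
    simp only [this]
    rw [integral_complex_ofReal, integral_const_mul]
  obtain ⟨hc1, hc2⟩ := conv_left hXi hEi hEev
  obtain ⟨hc3, hc4⟩ := conv_right hXi hEi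
  have hχχ : ∀ z w : ℂ, |χ w - χ z| ≤ ε * Real.exp (2 * ‖z - w‖) * χ z := by
    intro z w
    have hd : |‖z‖ - ‖w‖| ≤ ‖z - w‖ := abs_norm_sub_norm_le z w
    have hd0 := norm_nonneg (z - w)
    have hχw : χ w = χ z * Real.exp (ε * (‖z‖ - ‖w‖)) := by
      simp only [hχ]; rw [← Real.exp_add]; congr 1; ring
    set t := ε * (‖z‖ - ‖w‖) with ht
    have ht1 : |t| ≤ ε * ‖z - w‖ := by
      rw [ht, abs_mul, abs_of_pos hε0]; gcongr
    have ht2 : |Real.exp t - 1| ≤ |t| * Real.exp |t| := by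
      rcases le_or_gt 0 t with h | h
      · rw [abs_of_nonneg h, abs_of_nonneg (by linarith [Real.one_le_exp h])]
        have h1 := Real.add_one_le_exp (-t)
        have h2 : Real.exp (-t) * Real.exp t = 1 := by rw [← Real.exp_add]; simp
        nlinarith [Real.exp_pos t]
      · rw [abs_of_neg h, abs_of_nonpos (by linarith [Real.exp_le_one_iff.2 h.le])]
        have h1 := Real.add_one_le_exp t
        have h2 : 1 ≤ Real.exp (-t) := Real.one_le_exp (by linarith)
        nlinarith
    rw [hχw, show χ z * Real.exp t - χ z = χ z * (Real.exp t - 1) by ring, abs_mul,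
      abs_of_pos (hχ0 z), mul_comm]
    apply mul_le_mul_of_nonneg_right _ (hχ0 z).le
    have h5 : |t| ≤ ‖z - w‖ := ht1.trans (by nlinarith)
    calc |Real.exp t - 1| ≤ |t| * Real.exp |t| := ht2
      _ ≤ (ε * ‖z - w‖) * Real.exp ‖z - w‖ := by gcongr
      _ = ε * (‖z - w‖ * Real.exp ‖z - w‖) := by ring
      _ ≤ ε * (Real.exp ‖z - w‖ * Real.exp ‖z - w‖) := by
          gcongr; linarith [Real.add_one_le_exp ‖z - w‖]
      _ = _ := by rw [← Real.exp_add]; ring_nf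
  have hpt : ∀ p : ℂ × ℂ, ‖(χ p.2 : ℂ) * F p - (χ p.1 : ℂ) * F p‖ ≤
      (ε * Real.exp 4) * (X p.1 * E (p.1 - p.2) + X p.2 * E (p.1 - p.2)) := by
    rintro ⟨z, w⟩
    have h1 : ‖(χ w : ℂ) * F (z, w) - (χ z : ℂ) * F (z, w)‖ = |χ w - χ z| * ‖F (z, w)‖ := by
      rw [← sub_mul, norm_mul, ← Complex.ofReal_sub, Complex.norm_real, Real.norm_eq_abs]
    simp only
    rw [h1, hFn]
    simp only
    have hk : Real.exp (2 * ‖z - w‖) * Real.exp (-‖z - w‖ ^ 2 / 2) ≤ Real.exp 4 * E (z - w) := by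
      simp only [hE]
      rw [← Real.exp_add, ← Real.exp_add]
      apply Real.exp_le_exp.2
      nlinarith [sq_nonneg (‖z - w‖ - 4)]
    have hE0 : 0 ≤ E (z - w) := (Real.exp_pos _).le
    have ha := hχχ z w
    have hb : |χ w - χ z| ≤ ε * Real.exp (2 * ‖z - w‖) * χ w := by
      have := hχχ w z
      rwa [abs_sub_comm, norm_sub_rev] at this
    have hgen : ∀ c, 0 ≤ c → |χ w - χ z| ≤ ε * Real.exp (2 * ‖z - w‖) * c →
        |χ w - χ z| * Real.exp (-‖z - w‖ ^ 2 / 2) ≤ ε * Real.exp 4 * (c * E (z - w)) := by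
      intro c hc h
      calc _ ≤ ε * Real.exp (2 * ‖z - w‖) * c * Real.exp (-‖z - w‖ ^ 2 / 2) := by gcongr
        _ = ε * c * (Real.exp (2 * ‖z - w‖) * Real.exp (-‖z - w‖ ^ 2 / 2)) := by ring
        _ ≤ ε * c * (Real.exp 4 * E (z - w)) :=
            mul_le_mul_of_nonneg_left hk (by positivity)
        _ = _ := by ring
    have hz0 := hU0 z
    have hw0 := hU0 w
    have hXz : 0 ≤ ε * Real.exp 4 * (X z * E (z - w)) :=
      mul_nonneg (by positivity) (mul_nonneg (hX0 z) hE0)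
    have hXw : 0 ≤ ε * Real.exp 4 * (X w * E (z - w)) :=
      mul_nonneg (by positivity) (mul_nonneg (hX0 w) hE0)
    rcases le_total (U z) (U w) with hzw | hzw
    · have h2 : U z * U w ^ 3 ≤ U w ^ 4 := by
        calc U z * U w ^ 3 ≤ U w * U w ^ 3 := by gcongr
          _ = _ := by ring
      calc |χ w - χ z| * (U z * U w ^ 3 * Real.exp (-‖z - w‖ ^ 2 / 2))
          = (|χ w - χ z| * Real.exp (-‖z - w‖ ^ 2 / 2)) * (U z * U w ^ 3) := by ring
        _ ≤ (ε * Real.exp 4 * (χ w * E (z - w))) * U w ^ 4 :=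
            mul_le_mul (hgen _ (hχ0 w).le hb) h2 (by positivity)
              (mul_nonneg (by positivity) (mul_nonneg (hχ0 w).le hE0))
        _ = ε * Real.exp 4 * (X w * E (z - w)) := by simp only [hX]; ring
        _ ≤ _ := by rw [mul_add]; linarith
    · have h2 : U z * U w ^ 3 ≤ U z ^ 4 := by
        calc U z * U w ^ 3 ≤ U z * U z ^ 3 := by gcongr
          _ = _ := by ring
      calc |χ w - χ z| * (U z * U w ^ 3 * Real.exp (-‖z - w‖ ^ 2 / 2))
          = (|χ w - χ z| * Real.exp (-‖z - w‖ ^ 2 / 2)) * (U z * U w ^ 3) := by ring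
        _ ≤ (ε * Real.exp 4 * (χ z * E (z - w))) * U z ^ 4 :=
            mul_le_mul (hgen _ (hχ0 z).le ha) h2 (by positivity)
              (mul_nonneg (by positivity) (mul_nonneg (hχ0 z).le hE0))
        _ = ε * Real.exp 4 * (X z * E (z - w)) := by simp only [hX]; ring
        _ ≤ _ := by rw [mul_add]; linarith
  have hmain := norm_integral_le_of_norm_le ((hc1.add hc3).const_mul (ε * Real.exp 4))
    (ae_of_all _ hpt)
  rw [integral_sub hA2 hA1, hI1, hI2, sub_zero, Complex.norm_real,
    Real.norm_of_nonneg (by positivity), integral_const_mul] at hmain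
  have hadd := integral_add hc1 hc3
  rw [hc2, hc4, hEI, ← hJ] at hadd
  simp only [Pi.add_apply] at hmain
  rw [hadd] at hmain
  have hee : ε * Real.exp 4 = 1 / 16 := by
    rw [hε, div_mul_eq_mul_div, ← Real.exp_add]; norm_num
  rw [hee] at hmain
  have hpi := Real.pi_pos
  have hJz : J = 0 := by nlinarith
  have hae := (integral_eq_zero_iff_of_nonneg hX0 hXi).1 hJz
  have hXc : Continuous X := by fun_prop
  have hXz : X = fun _ => 0 := (hXc.ae_eq_iff_eq volume continuous_const).1 hae
  have hz := congrFun hXz z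
  simp only [hX, hU] at hz
  have h1 : ‖f z‖ = 0 := by
    by_contra hne
    have h2 : 0 < ‖f z‖ := lt_of_le_of_ne (norm_nonneg _) (Ne.symm hne)
    have h3 : 0 < χ z * (‖f z‖ * Real.exp (-‖z‖ ^ 2 / 2)) ^ 4 := mul_pos (hχ0 z) (by positivity)
    linarith
  exact norm_eq_zero.1 h1

/-- **Counting zeros of MP-stationary waves.** If `u = f e^{-|z|²/2}` (with `f` entire, not
identically zero) is bounded, tends to `0` at infinity, and satisfies `λu + μΛu = Π(|u|²u)`,
then the number `N(R)` of zeros of `u` in the disc `|z| < R` satisfies `N(R)/R^η → 0`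
for every `η > η₀ = (1/2 + (1/2)(log 2/log 3))⁻¹`. -/
theorem mp_stationary_wave_zero_count (lam mu : ℝ) (f : ℂ → ℂ) (hf : Differentiable ℂ f)
    (hf0 : ∃ z : ℂ, f z ≠ 0)
    (u : ℂ → ℂ) (hu : ∀ z : ℂ, u z = f z * Complex.exp (-(‖z‖ : ℂ) ^ 2 / 2))
    (hbd : ∃ M : ℝ, ∀ z : ℂ, ‖u z‖ ≤ M)
    (hdecay : Filter.Tendsto u (Filter.cocompact ℂ) (nhds 0))
    (heq : ∀ z : ℂ,
      (lam : ℂ) * u z + (mu : ℂ) * (z * deriv f z * Complex.exp (-(‖z‖ : ℂ) ^ 2 / 2)) =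
        LLLProj (fun w : ℂ => (‖u w‖ : ℂ) ^ 2 * u w) z) :
    ∀ η : ℝ, η > (1 / 2 + (1 / 2) * (Real.log 2 / Real.log 3))⁻¹ →
      Filter.Tendsto
        (fun R : ℝ => (({z : ℂ | u z = 0 ∧ ‖z‖ < R}.ncard : ℝ) / R ^ η))
        Filter.atTop (nhds 0) := by
  have hnz : ∀ z : ℂ, -(‖z‖ : ℂ) ^ 2 / 2 = ((-‖z‖ ^ 2 / 2 : ℝ) : ℂ) := by
    intro z; push_cast; ring
  have hun : ∀ z, ‖u z‖ = ‖f z‖ * Real.exp (-‖z‖ ^ 2 / 2) := by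
    intro z
    rw [hu, norm_mul, hnz, ← Complex.ofReal_exp, Complex.norm_real,
      Real.norm_of_nonneg (Real.exp_pos _).le]
  obtain ⟨M0, hM0⟩ := hbd
  have hM : 0 ≤ M0 := (norm_nonneg _).trans (hM0 0)
  have hee : ∀ z : ℂ, Real.exp (-‖z‖ ^ 2 / 2) * Real.exp (‖z‖ ^ 2 / 2) = 1 := by
    intro z; rw [← Real.exp_add, show -‖z‖ ^ 2 / 2 + ‖z‖ ^ 2 / 2 = 0 by ring, Real.exp_zero]
  have hfM : ∀ z, ‖f z‖ ≤ M0 * Real.exp (‖z‖ ^ 2 / 2) := by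
    intro z
    have h := mul_le_mul_of_nonneg_right (hM0 z) (Real.exp_pos (‖z‖ ^ 2 / 2)).le
    rwa [hun, mul_assoc, hee, mul_one] at h
  have hfM' : ∀ z, ‖f z‖ ≤ M0 * Real.exp ((1 / 2) * ‖z‖ ^ 2) := by
    intro z
    have h := hfM z
    rwa [show ‖z‖ ^ 2 / 2 = (1 / 2) * ‖z‖ ^ 2 by ring] at h
  have heq' : ∀ z, (lam : ℂ) * f z + mu * (z * deriv f z) =
      (Real.pi : ℂ)⁻¹ * ∫ w : ℂ, Complex.exp ((starRingEnd ℂ) w * z) *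
      (((starRingEnd ℂ) (f w)) * f w ^ 2 * (Real.exp (-2 * ‖w‖ ^ 2) : ℂ)) := by
    intro z
    have h := heq z
    have hI : ∀ w : ℂ, Complex.exp ((starRingEnd ℂ) w * z - (‖w‖ : ℂ) ^ 2 / 2) *
        ((‖u w‖ : ℂ) ^ 2 * u w) = Complex.exp ((starRingEnd ℂ) w * z) *
      (((starRingEnd ℂ) (f w)) * f w ^ 2 * (Real.exp (-2 * ‖w‖ ^ 2) : ℂ)) := by
      intro w
      have h2 : (starRingEnd ℂ) (f w) * f w = ((‖f w‖ ^ 2 : ℝ) : ℂ) := by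
        rw [mul_comm, Complex.mul_conj, Complex.normSq_eq_norm_sq]
      have h3 : (starRingEnd ℂ) (f w) * f w ^ 2 = ((‖f w‖ ^ 2 : ℝ) : ℂ) * f w := by
        rw [← h2]; ring
      rw [h3, hun, hu, sub_eq_add_neg, Complex.exp_add]
      have h4 : Complex.exp (-((‖w‖ : ℂ) ^ 2 / 2)) * ((Real.exp (-‖w‖ ^ 2 / 2) : ℝ) : ℂ) ^ 2 *
          Complex.exp (-(‖w‖ : ℂ) ^ 2 / 2) = (Real.exp (-2 * ‖w‖ ^ 2) : ℂ) := by
        rw [Complex.ofReal_exp, Complex.ofReal_exp, ← Complex.exp_nat_mul, ← Complex.exp_add,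
          ← Complex.exp_add]
        congr 1; push_cast; ring
      rw [← h4]
      push_cast
      ring
    rw [LLLProj, integral_congr_ae (ae_of_all _ hI), hu] at h
    have hne : Complex.exp (-(‖z‖ : ℂ) ^ 2 / 2) ≠ 0 := Complex.exp_ne_zero _
    apply mul_right_cancel₀ hne
    linear_combination h
  have hset : ∀ R : ℝ, {z : ℂ | u z = 0 ∧ ‖z‖ < R} = {z : ℂ | f z = 0 ∧ ‖z‖ < R} := by
    intro R; ext z
    simp only [Set.mem_setOf_eq, hu, mul_eq_zero, Complex.exp_ne_zero, or_false]
  intro η hη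
  simp only [hset]
  by_cases hlm : lam ≠ 0 ∨ mu ≠ 0
  · have hdec : ∀ ε : ℝ, 0 < ε → ∃ R0 : ℝ, ∀ z, R0 ≤ ‖z‖ →
        ‖f z‖ * Real.exp (-‖z‖ ^ 2 / 2) ≤ ε := by
      intro ε hε
      have h1 : ∀ᶠ z in Filter.cocompact ℂ, ‖u z‖ < ε := by
        have := hdecay.norm
        rw [norm_zero] at this
        exact this.eventually (gt_mem_nhds hε)
      rw [← Metric.cobounded_eq_cocompact, ← comap_norm_atTop, Filter.eventually_comap] at h1
      obtain ⟨R0, hR0⟩ := Filter.eventually_atTop.1 h1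
      refine ⟨R0, fun z hz => ?_⟩
      rw [← hun]
      exact (hR0 ‖z‖ hz z rfl).le
    obtain ⟨C, α, hα, hC⟩ := gauss_decay hf hM hlm hfM heq' hdec
    exact zero_count_of_gauss hf hf0 hα hC lam mu hlm
      (fun n => coeff_relation hf hfM' lam mu heq' n) hη
  · push Not at hlm
    obtain ⟨hl, hm⟩ := hlm
    obtain ⟨z0, hz0⟩ := hf0
    refine absurd (zero_case hf hM hfM' (fun z => ?_) z0) hz0
    have h := heq' z
    rw [hl, hm, Complex.ofReal_zero, zero_mul, zero_mul, add_zero] at h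
    exact (mul_eq_zero.1 h.symm).resolve_left (inv_ne_zero (by exact_mod_cast Real.pi_ne_zero))
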